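/- (Horn inequalities for the Kirwan cone.) Let (Λ,t) ∈ E(r,s). Then (Λ,t) lies in the Kirwan cone 𝒦(r,s) if and only if T(Λ) = r·t and for all d ∈ [r−1] and all 𝐉 ∈ Intersecting(d,r,s), T_𝐉(Λ) ≤ d·t. -/

import Mathlib

open Module

noncomputable section

/-- A complete flag on `ℂ^m`: an increasing family of subspaces with
`dim (F i) = i + 1` (`0`-based indexing, so `F i` is the `i+1`-st step). -/
structure Flagg (m : ℕ) where
  F : Fin m → Submodule ℂ (Fin m → ℂ)
  mono : Monotone F
  rank_eq : ∀ i : Fin m, finrank ℂ (F i) = (i : ℕ) + 1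

/-- An `s`-tuple `J` of (strictly increasing) maps `[d] → [r]` is *intersecting* if
for every `s`-tuple of complete flags on `ℂ^r` the corresponding intersection of
Schubert varieties in the Grassmannian `Gr(d, ℂ^r)` is nonempty. -/
def Intersecting {s d r : ℕ} (J : Fin s → Fin d → Fin r) : Prop :=
  ∀ F : Fin s → Flagg r, ∃ V : Submodule ℂ (Fin r → ℂ), finrank ℂ V = d ∧
    ∀ (l : Fin s) (k : Fin d), (k : ℕ) + 1 ≤ finrank ℂ ↥(V ⊓ (F l).F (J l k))

/-- `dim I = ∑_j (I(j) - j)`. -/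
def dimI {d r : ℕ} (J : Fin d → Fin r) : ℤ := ∑ k, ((J k : ℤ) - (k : ℤ))

/-- Expected dimension of a tuple `J ∈ Subsets(d,r,s)`. -/
def edim {s d r : ℕ} (J : Fin s → Fin d → Fin r) : ℤ :=
  (d : ℤ) * ((r : ℤ) - (d : ℤ)) - ∑ l, ((d : ℤ) * ((r : ℤ) - (d : ℤ)) - dimI (J l))

/-- `dim` for raw `ℕ`-valued increasing sequences. -/
def dimN {d : ℕ} (f : Fin d → ℕ) : ℤ := ∑ k, ((f k : ℤ) - (k : ℤ))

/-- Expected dimension for raw `ℕ`-valued tuples, with ambient dimension `n` explicit. -/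
def edimN {s d : ℕ} (n : ℕ) (f : Fin s → Fin d → ℕ) : ℤ :=
  (d : ℤ) * ((n : ℤ) - (d : ℤ)) - ∑ l, ((d : ℤ) * ((n : ℤ) - (d : ℤ)) - dimN (f l))

/-- `T(Λ) = ∑_l ∑_j Λ_l(j)`. -/
def TT {s r : ℕ} (Λ : Fin s → Fin r → ℝ) : ℝ := ∑ l, ∑ j, Λ l j

/-- `T_J(Λ) = ∑_l ∑_{j ∈ J_l} Λ_l(j)`. -/
def TJ {s d r : ℕ} (J : Fin s → Fin d → Fin r) (Λ : Fin s → Fin r → ℝ) : ℝ :=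
  ∑ l, ∑ k, Λ l (J l k)

/-- `Γ(J)_l(k) = k - J_l(k) + (r - d)`, a weakly decreasing real `d`-tuple. -/
def GammaT {s d r : ℕ} (J : Fin s → Fin d → Fin r) : Fin s → Fin d → ℝ :=
  fun l k => (k : ℝ) - (J l k : ℝ) + ((r : ℝ) - (d : ℝ))

/-- Membership of `(Λ, t)` in the Kirwan cone `𝒦(r,s)`: each `Λ_l` is weakly
decreasing and there are Hermitian matrices `A_1, …, A_s` summing to `t·I_r`
whose decreasingly-ordered spectra are the `Λ_l`. -/
def KirwanMem {s r : ℕ} (Λ : Fin s → Fin r → ℝ) (t : ℝ) : Prop :=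
  (∀ l, Antitone (Λ l)) ∧
  ∃ (A : Fin s → Matrix (Fin r) (Fin r) ℂ) (hA : ∀ l, (A l).IsHermitian),
    (∑ l, A l) = (t : ℂ) • (1 : Matrix (Fin r) (Fin r) ℂ) ∧
    ∀ l, ∃ e : Equiv.Perm (Fin r), ∀ i, Λ l i = (hA l).eigenvalues (e i)

/-- The subspace of a flag with `k` elements (so `flagAt G 0 = ⊥`). -/
def flagAt {m : ℕ} (G : Flagg m) : ℕ → Submodule ℂ (Fin m → ℂ)
  | 0 => ⊥
  | (k + 1) => if h : k < m then G.F ⟨k, h⟩ else ⊤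

/-- The space `ℒ_I(F,G)` of linear maps `φ : ℂ^r → ℂ^q` with
`φ(F_l(j)) ⊆ G_l(I_l(j) - j)` for all `l, j`. -/
def LSpace {s r q : ℕ} (I : Fin s → Fin r → ℕ) (F : Fin s → Flagg r) (G : Fin s → Flagg q) :
    Submodule ℂ ((Fin r → ℂ) →ₗ[ℂ] (Fin q → ℂ)) where
  carrier := {φ | ∀ (l : Fin s) (j : Fin r), ∀ v ∈ (F l).F j,
    φ v ∈ flagAt (G l) (I l j - (j : ℕ))}
  add_mem' := by
    intro a b ha hb l j v hv
    simpa using add_mem (ha l j v hv) (hb l j v hv)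
  zero_mem' := by
    intro l j v hv
    simp
  smul_mem' := by
    intro c a ha l j v hv
    simpa using Submodule.smul_mem _ c (ha l j v hv)

/-- The true dimension `tdim I`, for a raw tuple `I ∈ Subsets(r, r + q, s)`
(here `q = n - r`). -/
def tdim {s : ℕ} (r q : ℕ) (I : Fin s → Fin r → ℕ) : ℕ :=
  sInf {m : ℕ | ∃ (F : Fin s → Flagg r) (G : Fin s → Flagg q), finrank ℂ (LSpace I F G) = m}

/-- The kernel dimension `kdim I`. -/
def kdim {s : ℕ} (r q : ℕ) (I : Fin s → Fin r → ℕ) : ℕ :=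
  sInf {m : ℕ | ∃ (F : Fin s → Flagg r) (G : Fin s → Flagg q)
      (φ : (Fin r → ℂ) →ₗ[ℂ] (Fin q → ℂ)), φ ∈ LSpace I F G ∧
      finrank ℂ (LSpace I F G) = tdim r q I ∧ finrank ℂ (LinearMap.ker φ) = m}

/-- The (`0`-based) Schubert position of a subspace `W` w.r.t. a flag:
`posN Fl W k` is the least `j` with `dim (Fl(j) ⊓ W) = k + 1`. -/
def posN {m : ℕ} (Fl : Flagg m) (W : Submodule ℂ (Fin m → ℂ)) (k : ℕ) : ℕ :=
  sInf {j : ℕ | ∃ h : j < m, finrank ℂ ↥(Fl.F ⟨j, h⟩ ⊓ W) = k + 1}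

/-- The (`0`-based, `ℕ`-valued) kernel position `kPos(I)_l(k)`. -/
def kPosFun {s : ℕ} (r q : ℕ) (I : Fin s → Fin r → ℕ) (l : Fin s) (k : ℕ) : ℕ :=
  sInf {p : ℕ | ∃ (F : Fin s → Flagg r) (G : Fin s → Flagg q)
      (φ : (Fin r → ℂ) →ₗ[ℂ] (Fin q → ℂ)), φ ∈ LSpace I F G ∧
      finrank ℂ (LSpace I F G) = tdim r q I ∧
      finrank ℂ (LinearMap.ker φ) = kdim r q I ∧ posN (F l) (LinearMap.ker φ) k = p}

/-- Apply an `r`-tuple of reals at a natural index (junk value `0` out of range). -/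
def applyI {r : ℕ} (f : Fin r → ℝ) (j : ℕ) : ℝ := if h : j < r then f ⟨j, h⟩ else 0

/-- Apply an `r`-tuple of naturals at a natural index (junk value `0` out of range). -/
def applyN {r : ℕ} (f : Fin r → ℕ) (j : ℕ) : ℕ := if h : j < r then f ⟨j, h⟩ else 0

/-- The slope `slope_θ(J) = (1/d) ∑_l ∑_{j ∈ J_l} θ_l(j)` of a tuple. -/
def slopeT {s d r : ℕ} (θ : Fin s → Fin r → ℝ) (J : Fin s → Fin d → Fin r) : ℝ :=
  ((d : ℝ))⁻¹ * ∑ l, ∑ k, θ l (J l k)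

/-- The slope `slope_θ(W, F) = slope_θ(Pos(W, F))` of a (nonzero) subspace. -/
def slopeW {s r : ℕ} (θ : Fin s → Fin r → ℝ) (F : Fin s → Flagg r)
    (W : Submodule ℂ (Fin r → ℂ)) : ℝ :=
  ((finrank ℂ W : ℝ))⁻¹ * ∑ l, ∑ k ∈ Finset.range (finrank ℂ W), applyI (θ l) (posN (F l) W k)

end

section
open Module Matrix

/-- The `i`-th step of the flag attached to `H`: vectors `v` with `(H v)_j = 0` for `j > i`. -/
def stepSp {r : ℕ} (H : Matrix (Fin r) (Fin r) ℂ) (i : Fin r) : Submodule ℂ (Fin r → ℂ) where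
  carrier := {v | ∀ j, i < j → (H *ᵥ v) j = 0}
  add_mem' := by
    intro a b ha hb j hj
    simp [Matrix.mulVec_add, ha j hj, hb j hj]
  zero_mem' := by
    intro j hj
    simp
  smul_mem' := by
    intro c a ha j hj
    simp [Matrix.mulVec_smul, ha j hj]

lemma mem_stepSp {r : ℕ} (H : Matrix (Fin r) (Fin r) ℂ) (i : Fin r) (v : Fin r → ℂ) :
    v ∈ stepSp H i ↔ ∀ j, i < j → (H *ᵥ v) j = 0 := Iff.rfl

lemma stepSp_mono {r : ℕ} (H : Matrix (Fin r) (Fin r) ℂ) : Monotone (stepSp H) := by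
  intro i j hij v hv k hk
  exact hv k (lt_of_le_of_lt hij hk)

/-- Adapted orthonormal frames. -/
lemma exists_adapted {r : ℕ} : ∀ (d : ℕ) (K : Fin d → Submodule ℂ (Fin r → ℂ)),
    (∀ k : Fin d, (k : ℕ) + 1 ≤ finrank ℂ (K k)) →
    ∃ Q : Matrix (Fin r) (Fin d) ℂ, Qᴴ * Q = 1 ∧ ∀ k, (fun i => Q i k) ∈ K k := by
  intro d
  induction d with
  | zero =>
    intro K _
    exact ⟨0, by ext i; exact i.elim0, fun k => k.elim0⟩
  | succ d ih =>
    intro K hK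
    obtain ⟨Q, hQ, hQK⟩ := ih (fun k => K k.castSucc) (fun k => by simpa using hK k.castSucc)
    -- nontrivial kernel
    let φ : K (Fin.last d) →ₗ[ℂ] (Fin d → ℂ) := (Matrix.mulVecLin Qᴴ).comp (K (Fin.last d)).subtype
    have hker : ∃ v : K (Fin.last d), φ v = 0 ∧ v ≠ 0 := by
      have h1 : ¬ Function.Injective φ := by
        intro hinj
        have := LinearMap.finrank_le_finrank_of_injective hinj
        have h2 := hK (Fin.last d)
        simp at this h2
        omega
      rw [← LinearMap.ker_eq_bot, Submodule.eq_bot_iff] at h1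
      push Not at h1
      obtain ⟨v, hv, hv0⟩ := h1
      exact ⟨v, hv, hv0⟩
    obtain ⟨⟨v, hvK⟩, hv, hv0⟩ := hker
    have hv' : Qᴴ *ᵥ v = 0 := hv
    have hvne : v ≠ 0 := fun h => hv0 (by ext1; exact h)
    -- normalise
    have hpos : 0 < ∑ i, ‖v i‖ ^ 2 := by
      obtain ⟨i, hi⟩ := Function.ne_iff.mp hvne
      refine Finset.sum_pos' (fun _ _ => by positivity) ⟨i, Finset.mem_univ _, ?_⟩
      have : 0 < ‖v i‖ := norm_pos_iff.mpr hi
      positivity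
    set a : ℝ := Real.sqrt (∑ i, ‖v i‖ ^ 2) with ha
    have ha0 : 0 < a := Real.sqrt_pos.mpr hpos
    have ha2 : a * a = ∑ i, ‖v i‖ ^ 2 := Real.mul_self_sqrt hpos.le
    let w : Fin r → ℂ := ((a : ℂ)⁻¹) • v
    have hw : Qᴴ *ᵥ w = 0 := by simp [w, Matrix.mulVec_smul, hv']
    have hwK : w ∈ K (Fin.last d) := Submodule.smul_mem _ _ hvK
    have hww : ∑ i, star (w i) * w i = 1 := by
      have h3 : ∀ i, star (w i) * w i = (((a * a)⁻¹ : ℝ) : ℂ) * ((‖v i‖ ^ 2 : ℝ) : ℂ) := by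
        intro i
        have : star (v i) * v i = ((‖v i‖ ^ 2 : ℝ) : ℂ) := by
          have := Complex.conj_mul' (v i)
          simpa using this
        simp only [w, Pi.smul_apply, smul_eq_mul, star_mul']
        calc _ = star ((a:ℂ)⁻¹) * (a:ℂ)⁻¹ * (star (v i) * v i) := by ring
          _ = _ := by
            rw [this]
            simp
      rw [Finset.sum_congr rfl (fun i _ => h3 i), ← Finset.mul_sum, ← Complex.ofReal_sum, ← ha2]
      have : (a * a) ≠ 0 := by positivity
      rw [← Complex.ofReal_mul, inv_mul_cancel₀ this]; simp
    refine ⟨Matrix.of fun i k => Fin.lastCases (motive := fun _ => ℂ) (w i) (fun k => Q i k) k, ?_, ?_⟩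
    · have hq : ∀ k, ∑ i, star (Q i k) * w i = 0 := fun k => by
        have := congrFun hw k
        simpa [Matrix.mulVec, dotProduct] using this
      have hq' : ∀ k, ∑ i, star (w i) * Q i k = 0 := fun k => by
        have := congrArg star (hq k)
        rw [star_sum, star_zero] at this
        rw [← this]
        refine Finset.sum_congr rfl fun i _ => ?_
        simp [mul_comm]
      ext k l
      have hQ' := fun k l => congrFun (congrFun hQ k) l
      simp only [Matrix.mul_apply, Matrix.conjTranspose_apply] at hQ'
      simp only [Matrix.mul_apply, Matrix.conjTranspose_apply, Matrix.of_apply]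
      induction k using Fin.lastCases with
      | last =>
        induction l using Fin.lastCases with
        | last => simpa using hww
        | cast l =>
          have hne : Fin.last d ≠ l.castSucc := (Fin.castSucc_lt_last l).ne'
          simpa [Matrix.one_apply, hne] using hq' l
      | cast k =>
        induction l using Fin.lastCases with
        | last =>
          have hne : k.castSucc ≠ Fin.last d := (Fin.castSucc_lt_last k).ne
          simpa [Matrix.one_apply, hne] using hq k
        | cast l => simpa [Matrix.one_apply] using hQ' k l
    · intro k
      induction k using Fin.lastCases with
      | last => simpa using hwK
      | cast k => simpa using hQK k

lemma finrank_of_frame {r d : ℕ} (B : Matrix (Fin r) (Fin d) ℂ)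
    (C : Matrix (Fin d) (Fin r) ℂ) (hCB : C * B = 1)
    (K : Submodule ℂ (Fin r → ℂ)) (k : Fin d) (h : ∀ k' ≤ k, (fun i => B i k') ∈ K) :
    (k : ℕ) + 1 ≤ finrank ℂ K := by
  have hli : LinearIndependent ℂ (fun k' : Fin d => (fun i => B i k')) := by
    have : Function.Injective B.mulVec := by
      intro x y hxy
      have := congrArg (C *ᵥ ·) hxy
      simpa [Matrix.mulVec_mulVec, hCB] using this
    exact Matrix.mulVec_injective_iff.mp this
  let f : {k' : Fin d // k' ≤ k} → K := fun k' => ⟨fun i => B i k', h k' k'.2⟩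
  have hf : LinearIndependent ℂ f := by
    have := hli.comp (Subtype.val : {k' : Fin d // k' ≤ k} → Fin d) Subtype.val_injective
    exact LinearIndependent.of_comp K.subtype this
  have := hf.fintype_card_le_finrank
  have hc : Fintype.card {k' : Fin d // k' ≤ k} = (k : ℕ) + 1 := by
    rw [Fintype.card_subtype]
    have : (Finset.univ.filter fun k' : Fin d => k' ≤ k) = Finset.Iic k := by ext; simp
    rw [this, Fin.card_Iic]
  omega

/-- Projections of two frames of the same space agree. -/
lemma frame_proj {r d : ℕ} (V : Submodule ℂ (Fin r → ℂ)) (hV : finrank ℂ V = d)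
    (Q : Matrix (Fin r) (Fin d) ℂ) (hQ : Qᴴ * Q = 1) (hQV : ∀ k, (fun i => Q i k) ∈ V)
    (v : Fin r → ℂ) (hv : v ∈ V) : (Q * Qᴴ) *ᵥ v = v := by
  have hsub : LinearMap.range Q.mulVecLin ≤ V := by
    rw [Matrix.range_mulVecLin, Submodule.span_le]
    rintro _ ⟨k, rfl⟩
    exact hQV k
  have hinj : Function.Injective Q.mulVecLin := by
    intro x y hxy
    have := congrArg (Qᴴ *ᵥ ·) hxy
    simpa [Matrix.mulVec_mulVec, hQ] using this
  have heq : LinearMap.range Q.mulVecLin = V := by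
    apply Submodule.eq_of_le_of_finrank_eq hsub
    rw [LinearMap.finrank_range_of_inj hinj, hV]; simp
  rw [← heq] at hv
  obtain ⟨x, rfl⟩ := hv
  simp only [Matrix.mulVecLin_apply, Matrix.mulVec_mulVec]
  rw [Matrix.mul_assoc, hQ, Matrix.mul_one]

lemma frame_proj_eq {r d : ℕ} (V : Submodule ℂ (Fin r → ℂ)) (hV : finrank ℂ V = d)
    (Q Q' : Matrix (Fin r) (Fin d) ℂ) (hQ : Qᴴ * Q = 1) (hQV : ∀ k, (fun i => Q i k) ∈ V)
    (hQ' : Q'ᴴ * Q' = 1) (hQV' : ∀ k, (fun i => Q' i k) ∈ V) : Q * Qᴴ = Q' * Q'ᴴ := by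
  have key : ∀ (Q Q' : Matrix (Fin r) (Fin d) ℂ), Qᴴ * Q = 1 → (∀ k, (fun i => Q i k) ∈ V) →
      Q'ᴴ * Q' = 1 → (∀ k, (fun i => Q' i k) ∈ V) → (Q * Qᴴ) * (Q' * Q'ᴴ) = Q' * Q'ᴴ := by
    intro Q Q' hQ hQV hQ' hQV'
    have : Q * Qᴴ * Q' = Q' := by
      ext i k
      exact congrFun (frame_proj V hV Q hQ hQV _ (hQV' k)) i
    rw [← Matrix.mul_assoc, this]
  have h1 := key Q Q' hQ hQV hQ' hQV'
  have h2 := key Q' Q hQ' hQV' hQ hQV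
  have h3 := congrArg conjTranspose h1
  simp only [Matrix.conjTranspose_mul, Matrix.conjTranspose_conjTranspose] at h3
  exact h2.symm.trans h3

end

section
open Module Matrix

lemma exists_ringEquiv_of_algInd {ι : Type} [Finite ι] (g g' : ι → ℂ)
    (hg : AlgebraicIndependent ℚ g) (hg' : AlgebraicIndependent ℚ g') :
    ∃ σ : ℂ ≃+* ℂ, ∀ i, σ (g i) = g' i := by
  -- extension to transcendence bases
  have ext : ∀ g : ι → ℂ, AlgebraicIndependent ℚ g → ∃ t : Set ℂ, Set.range g ⊆ t ∧
      IsTranscendenceBasis ℚ ((↑) : t → ℂ) := by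
    intro g hg
    exact exists_isTranscendenceBasis_superset ((algebraicIndependent_subtype_range hg.injective).mpr hg)
  obtain ⟨t, hgt, ht⟩ := ext g hg
  obtain ⟨t', hgt', ht'⟩ := ext g' hg'
  have card : ∀ t : Set ℂ, IsTranscendenceBasis ℚ ((↑) : t → ℂ) →
      ∀ f : Set ℂ, f.Finite → Cardinal.mk (t \ f : Set ℂ) = Cardinal.mk ℂ := by
    intro t ht f hf
    have h1 : Cardinal.mk ℂ = Cardinal.mk t := by
      apply IsAlgClosed.cardinal_eq_cardinal_transcendence_basis_of_aleph0_lt' _ ht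
      · simp
      · simpa using Cardinal.aleph0_lt_continuum
    rw [h1]
    have hinf : Cardinal.aleph0 < Cardinal.mk t := by
      rw [← h1]; simpa using Cardinal.aleph0_lt_continuum
    have h2 : Cardinal.mk t ≤ Cardinal.mk (t \ f : Set ℂ) + Cardinal.mk f :=
      Cardinal.le_mk_sdiff_add_mk t f
    have hfl : Cardinal.mk f < Cardinal.aleph0 := Cardinal.lt_aleph0_iff_set_finite.mpr hf
    apply le_antisymm (Cardinal.mk_le_mk_of_subset Set.sdiff_subset)
    by_contra hlt
    push Not at hlt
    have := Cardinal.add_lt_of_lt hinf.le hlt (hfl.trans hinf)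
    exact absurd h2 (not_le.mpr this)
  have hc : Cardinal.mk (t \ Set.range g : Set ℂ) = Cardinal.mk (t' \ Set.range g' : Set ℂ) := by
    rw [card t ht _ (Set.finite_range g), card t' ht' _ (Set.finite_range g')]
  obtain ⟨e0⟩ := Cardinal.eq.mp hc
  -- index both bases by a sum
  have tb : ∀ (g : ι → ℂ) (hg : AlgebraicIndependent ℚ g) (t : Set ℂ) (hgt : Set.range g ⊆ t)
      (ht : IsTranscendenceBasis ℚ ((↑) : t → ℂ)),
      IsTranscendenceBasis ℚ (Sum.elim g ((↑) : (t \ Set.range g : Set ℂ) → ℂ)) := by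
    intro g hg t hgt ht
    have hinj : Function.Injective (Sum.elim g ((↑) : (t \ Set.range g : Set ℂ) → ℂ)) := by
      rintro (a | a) (b | b) hab
      · exact congrArg _ (hg.injective hab)
      · exact absurd ⟨a, hab⟩ b.2.2
      · exact absurd ⟨b, hab.symm⟩ a.2.2
      · exact congrArg _ (Subtype.ext hab)
    have hr : Set.range (Sum.elim g ((↑) : (t \ Set.range g : Set ℂ) → ℂ)) = t := by
      rw [Set.Sum.elim_range]
      simp only [Subtype.range_coe_subtype, Set.ofPred_mem_eq]
      exact Set.union_sdiff_cancel hgt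
    rw [← isTranscendenceBasis_subtype_range hinj]
    rw [hr]; exact ht
  have hv := tb g hg t hgt ht
  have hw := tb g' hg' t' hgt' ht'
  set v := Sum.elim g ((↑) : (t \ Set.range g : Set ℂ) → ℂ) with hvdef
  set w := Sum.elim g' ((↑) : (t' \ Set.range g' : Set ℂ) → ℂ) with hwdef
  let e : ι ⊕ (t \ Set.range g : Set ℂ) ≃ ι ⊕ (t' \ Set.range g' : Set ℂ) :=
    Equiv.sumCongr (Equiv.refl ι) e0
  let := IsAlgClosed.isAlgClosure_of_transcendence_basis v hv
  let := IsAlgClosed.isAlgClosure_of_transcendence_basis w hw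
  let E : Algebra.adjoin ℚ (Set.range v) ≃+* Algebra.adjoin ℚ (Set.range w) :=
    (hv.1.aevalEquiv.symm.trans ((MvPolynomial.renameEquiv ℚ e).trans hw.1.aevalEquiv)).toRingEquiv
  refine ⟨IsAlgClosure.equivOfEquiv ℂ ℂ E, fun i => ?_⟩
  have hE : ∀ x, (E (hv.1.aevalEquiv (MvPolynomial.X x)) : ℂ) = w (e x) := by
    intro x
    simp [E]
  have h1 := IsAlgClosure.equivOfEquiv_algebraMap ℂ ℂ E
    (hv.1.aevalEquiv (MvPolynomial.X (Sum.inl i)))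
  have h2 : algebraMap (Algebra.adjoin ℚ (Set.range v)) ℂ
    (hv.1.aevalEquiv (MvPolynomial.X (Sum.inl i))) = g i := by
    simp [hvdef]
  rw [h2] at h1
  rw [h1]
  exact hE (Sum.inl i)

lemma dense_algInd (n : ℕ) : Dense {g : Fin n → ℂ | AlgebraicIndependent ℚ g} := by
  induction n with
  | zero =>
    have : {g : Fin 0 → ℂ | AlgebraicIndependent ℚ g} = Set.univ := by
      ext g
      simp only [Set.mem_ofPred_eq, Set.mem_univ, iff_true]
      rw [algebraicIndependent_empty_type_iff]
      exact (algebraMap ℚ ℂ).injective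
    rw [this]; exact dense_univ
  | succ n ih =>
    rw [Metric.dense_iff] at ih ⊢
    intro x ε hε
    obtain ⟨g, hg1, hg2⟩ := ih (fun i => x i.succ) ε hε
    let A := Algebra.adjoin ℚ (Set.range g)
    have : Countable A := by
      have : Countable (MvPolynomial (Fin n) ℚ) := by
        rw [← Cardinal.mk_le_aleph0_iff]
        refine (MvPolynomial.cardinalMk_le_max).trans ?_
        simp
      have : Function.Surjective hg2.aevalEquiv := hg2.aevalEquiv.surjective
      exact this.countable
    have hcount : Set.Countable {z : ℂ | IsAlgebraic A z} := Algebraic.countable A ℂ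
    have hd : Dense ({z : ℂ | IsAlgebraic A z}ᶜ) := hcount.dense_compl ℝ
    obtain ⟨z, hz1, hz2⟩ := Metric.dense_iff.mp hd (x 0) ε hε
    refine ⟨Fin.cons z g, ?_, ?_⟩
    · rw [Metric.mem_ball, dist_pi_lt_iff hε]
      intro i
      refine Fin.cases ?_ (fun i => ?_) i
      · simpa using hz1
      · simpa using (dist_pi_lt_iff hε).mp hg1 i
    · have h := (hg2.option_iff_transcendental z).mpr hz2
      have h' := h.comp (finSuccEquiv n) (finSuccEquiv n).injective
      have heq : (Fin.cons z g : Fin (n + 1) → ℂ) = (fun o => o.elim z g) ∘ ⇑(finSuccEquiv n) := by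
        ext i
        refine Fin.cases ?_ (fun i => ?_) i <;> simp
      rw [Set.mem_ofPred_eq, heq]
      exact h'

lemma dense_algInd' {ι : Type} [Fintype ι] : Dense {g : ι → ℂ | AlgebraicIndependent ℚ g} := by
  have e := Fintype.equivFin ι
  let h : (Fin (Fintype.card ι) → ℂ) ≃ₜ (ι → ℂ) := (Homeomorph.piCongrLeft (Y := fun _ => ℂ) e).symm
  have := h.surjective.denseRange.dense_image h.continuous (dense_algInd (Fintype.card ι))
  refine this.mono ?_
  rintro _ ⟨g, hg, rfl⟩
  have := AlgebraicIndependent.comp hg e e.injective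
  convert! this using 1

end

section
open Module Matrix

/-- Matrix form of nonemptiness of the intersection of Schubert varieties. -/
def Sol {s d r : ℕ} (H : Fin s → Matrix (Fin r) (Fin r) ℂ) (J : Fin s → Fin d → Fin r) : Prop :=
  ∃ Q : Fin s → Matrix (Fin r) (Fin d) ℂ, (∀ l, (Q l)ᴴ * Q l = 1) ∧
    (∀ l l', Q l * (Q l)ᴴ = Q l' * (Q l')ᴴ) ∧ ∀ l k j, J l k < j → (H l * Q l) j k = 0

lemma sol_of_subspace {s d r : ℕ} (H : Fin s → Matrix (Fin r) (Fin r) ℂ)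
    (J : Fin s → Fin d → Fin r) (V : Submodule ℂ (Fin r → ℂ)) (hV : finrank ℂ V = d)
    (h : ∀ (l : Fin s) (k : Fin d), (k : ℕ) + 1 ≤ finrank ℂ ↥(V ⊓ stepSp (H l) (J l k))) :
    Sol H J := by
  have := fun l => exists_adapted d (fun k => V ⊓ stepSp (H l) (J l k)) (h l)
  choose Q hQ hQm using this
  refine ⟨Q, hQ, fun l l' => ?_, fun l k j hj => ?_⟩
  · exact frame_proj_eq V hV _ _ (hQ l) (fun k => (hQm l k).1) (hQ l') (fun k => (hQm l' k).1)
  · exact (hQm l k).2 j hj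

lemma subspace_of_frames {s d r : ℕ} (hs : 0 < s) (K : Fin s → Fin d → Submodule ℂ (Fin r → ℂ))
    (hK : ∀ l, Monotone (K l))
    (B : Fin s → Matrix (Fin r) (Fin d) ℂ) (C : Fin s → Matrix (Fin d) (Fin r) ℂ)
    (hCB : ∀ l, C l * B l = 1) (hBC : ∀ l l', B l * C l = B l' * C l')
    (hm : ∀ l k, (fun i => B l i k) ∈ K l k) :
    ∃ V : Submodule ℂ (Fin r → ℂ), finrank ℂ V = d ∧
      ∀ (l : Fin s) (k : Fin d), (k : ℕ) + 1 ≤ finrank ℂ ↥(V ⊓ K l k) := by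
  let l0 : Fin s := ⟨0, hs⟩
  refine ⟨LinearMap.range (B l0).mulVecLin, ?_, fun l k => ?_⟩
  · have hinj : Function.Injective (B l0).mulVecLin := by
      intro x y hxy
      have := congrArg (C l0 *ᵥ ·) hxy
      simpa [Matrix.mulVec_mulVec, hCB] using this
    rw [LinearMap.finrank_range_of_inj hinj]; simp
  · refine finrank_of_frame (B l) (C l) (hCB l) _ k fun k' hk' => ⟨?_, ?_⟩
    · have : B l = B l0 * (C l0 * B l) := by
        rw [← Matrix.mul_assoc, hBC l0 l, Matrix.mul_assoc, hCB, Matrix.mul_one]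
      refine ⟨fun i => (C l0 * B l) i k', ?_⟩
      ext i
      conv_rhs => rw [this]
      rfl
    · exact hK l hk' (hm l k')

lemma sol_map {s d r : ℕ} (hs : 0 < s) (H : Fin s → Matrix (Fin r) (Fin r) ℂ)
    (J : Fin s → Fin d → Fin r) (hJ : ∀ l, Monotone (J l)) (σ : ℂ ≃+* ℂ) (h : Sol H J) :
    Sol (fun l => (H l).map σ) J := by
  obtain ⟨Q, hQ, hQQ, hv⟩ := h
  obtain ⟨V, hV, hd⟩ := subspace_of_frames hs
    (fun l k => stepSp ((H l).map σ) (J l k)) (fun l => (stepSp_mono _).comp (hJ l))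
    (fun l => (Q l).map σ) (fun l => ((Q l)ᴴ).map σ)
    (fun l => by
      rw [← Matrix.map_mul, hQ l]
      exact Matrix.map_one _ (map_zero σ) (map_one σ))
    (fun l l' => by rw [← Matrix.map_mul, ← Matrix.map_mul, hQQ l l'])
    (fun l k j hj => by
      have h1 := congrArg σ (hv l k j hj)
      have h2 : ((H l).map σ * (Q l).map σ) j k = 0 := by
        rw [← Matrix.map_mul]; simpa using h1
      exact h2)
  exact sol_of_subspace _ J V hV hd

lemma norm_entry_le_one {m n : Type*} [Fintype m] [Fintype n] [DecidableEq n] (Q : Matrix m n ℂ)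
    (hQ : Qᴴ * Q = 1) (i : m) (k : n) : ‖Q i k‖ ≤ 1 := by
  have h := congrFun (congrFun hQ k) k
  simp only [Matrix.mul_apply, Matrix.conjTranspose_apply, Matrix.one_apply_eq] at h
  have h2 : ∑ i, ‖Q i k‖ ^ 2 = 1 := by
    have : ∀ i, star (Q i k) * Q i k = ((‖Q i k‖ ^ 2 : ℝ) : ℂ) := fun i => by
      simpa using Complex.conj_mul' (Q i k)
    simp only [this] at h
    exact_mod_cast h
  have h3 : ‖Q i k‖ ^ 2 ≤ 1 := by
    rw [← h2]
    exact Finset.single_le_sum (f := fun i => ‖Q i k‖ ^ 2) (fun _ _ => by positivity)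
      (Finset.mem_univ i)
  have := norm_nonneg (Q i k)
  nlinarith

lemma isCompact_frames (m n : Type) [Fintype m] [Fintype n] [DecidableEq n] :
    IsCompact {Q : Matrix m n ℂ | Qᴴ * Q = 1} := by
  have hcl : IsClosed {Q : Matrix m n ℂ | Qᴴ * Q = 1} :=
    isClosed_eq (by fun_prop) continuous_const
  have hK : IsCompact (Set.univ.pi fun _ : m => Set.univ.pi fun _ : n => Metric.closedBall (0:ℂ) 1) :=
    isCompact_univ_pi fun _ => isCompact_univ_pi fun _ => isCompact_closedBall _ _
  refine IsCompact.of_isClosed_subset hK hcl ?_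
  intro Q hQ i _ k _
  simpa using norm_entry_le_one Q hQ i k

lemma isClosed_sol {s d r : ℕ} (J : Fin s → Fin d → Fin r) :
    IsClosed {H : Fin s → Matrix (Fin r) (Fin r) ℂ | Sol H J} := by
  let K : Set (Fin s → Matrix (Fin r) (Fin d) ℂ) :=
    Set.univ.pi fun _ => {Q : Matrix (Fin r) (Fin d) ℂ | Qᴴ * Q = 1}
  have hK : IsCompact K := isCompact_univ_pi fun _ => isCompact_frames _ _
  have : CompactSpace K := isCompact_iff_compactSpace.mp hK
  let S : Set (K × (Fin s → Matrix (Fin r) (Fin r) ℂ)) :=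
    {p | (∀ l l', p.1.1 l * (p.1.1 l)ᴴ = p.1.1 l' * (p.1.1 l')ᴴ) ∧
      ∀ l k j, J l k < j → (p.2 l * p.1.1 l) j k = 0}
  have hS : IsClosed S := by
    have hc1 : ∀ l, Continuous fun p : K × (Fin s → Matrix (Fin r) (Fin r) ℂ) => p.1.1 l :=
      fun l => (continuous_apply l).comp (continuous_subtype_val.comp continuous_fst)
    have hc2 : ∀ l, Continuous fun p : K × (Fin s → Matrix (Fin r) (Fin r) ℂ) => p.2 l :=
      fun l => (continuous_apply l).comp continuous_snd
    have e : S = (⋂ l, ⋂ l', {p | p.1.1 l * (p.1.1 l)ᴴ = p.1.1 l' * (p.1.1 l')ᴴ}) ∩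
      (⋂ l, ⋂ k, ⋂ j, ⋂ _ : J l k < j, {p | (p.2 l * p.1.1 l) j k = 0}) := by
      ext p; simp [S]
    rw [e]
    refine IsClosed.inter ?_ ?_
    · refine isClosed_iInter fun l => isClosed_iInter fun l' => isClosed_eq ?_ ?_
      · exact (hc1 l).matrix_mul (hc1 l).matrix_conjTranspose
      · exact (hc1 l').matrix_mul (hc1 l').matrix_conjTranspose
    · refine isClosed_iInter fun l => isClosed_iInter fun k => isClosed_iInter fun j =>
        isClosed_iInter fun _ => isClosed_eq ?_ continuous_const
      exact ((hc2 l).matrix_mul (hc1 l)).matrix_elem j k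
  have h := isClosedMap_snd_of_compactSpace S hS
  convert! h using 1
  ext H
  constructor
  · rintro ⟨Q, h1, h2, h3⟩
    exact ⟨(⟨Q, fun l _ => h1 l⟩, H), ⟨h2, h3⟩, rfl⟩
  · rintro ⟨⟨⟨Q, h1⟩, H'⟩, ⟨h2, h3⟩, rfl⟩
    exact ⟨Q, fun l => h1 l trivial, h2, h3⟩

lemma flag_step {r : ℕ} (F : Flagg r) : ∃ H : Matrix (Fin r) (Fin r) ℂ,
    ∀ i, stepSp H i ≤ F.F i := by
  obtain ⟨Q, hQ, hQF⟩ := exists_adapted r F.F (fun k => (F.rank_eq k).ge)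
  have hQ' : Q * Qᴴ = 1 := mul_eq_one_comm.mp hQ
  refine ⟨Qᴴ, fun i v hv => ?_⟩
  have h1 : v = Q *ᵥ (Qᴴ *ᵥ v) := by rw [Matrix.mulVec_mulVec, hQ', Matrix.one_mulVec]
  rw [h1, Matrix.mulVec_eq_sum]
  refine Submodule.sum_mem _ fun j _ => ?_
  by_cases hj : i < j
  · rw [hv j hj]; simp
  · rw [op_smul_eq_smul]
    exact Submodule.smul_mem _ _ (F.mono (not_lt.mp hj) (hQF j))

lemma intersecting_of_sol {s d r : ℕ} (hs : 0 < s) (J : Fin s → Fin d → Fin r)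
    (hJ : ∀ l, Monotone (J l)) (h : ∀ H, Sol H J) : Intersecting J := by
  intro F
  choose H hH using fun l => flag_step (F l)
  obtain ⟨Q, h1, h2, h3⟩ := h H
  exact subspace_of_frames hs (fun l k => (F l).F (J l k)) (fun l => (F l).mono.comp (hJ l))
    Q (fun l => (Q l)ᴴ) h1 h2 (fun l k => hH l _ (h3 l k))

/-- Existence of generic flags. -/
lemma exists_generic (s r : ℕ) (hs : 0 < s) : ∃ H : Fin s → Matrix (Fin r) (Fin r) ℂ,
    (∀ l, IsUnit (H l).det) ∧ ∀ (d : ℕ) (J : Fin s → Fin d → Fin r), (∀ l, StrictMono (J l)) →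
      ∀ V : Submodule ℂ (Fin r → ℂ), finrank ℂ V = d →
      (∀ (l : Fin s) (k : Fin d), (k : ℕ) + 1 ≤ finrank ℂ ↥(V ⊓ stepSp (H l) (J l k))) →
      Intersecting J := by
  let φ : (Fin s × Fin r × Fin r → ℂ) → (Fin s → Matrix (Fin r) (Fin r) ℂ) :=
    fun g l => Matrix.of fun i j => g (l, i, j)
  have hφ : Continuous φ := by
    refine continuous_pi fun l => continuous_matrix fun i j => ?_
    exact continuous_apply (l, i, j)
  have hφs : Function.Surjective φ := fun H => ⟨fun p => H p.1 p.2.1 p.2.2, rfl⟩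
  have hD : Dense (Set.image φ {g | AlgebraicIndependent ℚ g}) :=
    hφs.denseRange.dense_image hφ dense_algInd'
  have hO : IsOpen {H : Fin s → Matrix (Fin r) (Fin r) ℂ | ∀ l, (H l).det ≠ 0} := by
    have : {H : Fin s → Matrix (Fin r) (Fin r) ℂ | ∀ l, (H l).det ≠ 0} =
      ⋂ l, {H | (H l).det ≠ 0} := by ext; simp
    rw [this]
    refine isOpen_iInter_of_finite fun l => isOpen_ne_fun ?_ continuous_const
    exact (continuous_apply l).matrix_det
  obtain ⟨H, hH1, ⟨g, hg, rfl⟩⟩ := hD.inter_open_nonempty _ hO ⟨fun _ => 1, by simp⟩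
  refine ⟨φ g, fun l => isUnit_iff_ne_zero.mpr (hH1 l), fun d J hJ V hV h => ?_⟩
  refine intersecting_of_sol hs J (fun l => (hJ l).monotone) ?_
  have hsol := sol_of_subspace (φ g) J V hV h
  have hsub : Set.image φ {g | AlgebraicIndependent ℚ g} ⊆ {H | Sol H J} := by
    rintro _ ⟨g', hg', rfl⟩
    obtain ⟨σ, hσ⟩ := exists_ringEquiv_of_algInd g g' hg hg'
    have := sol_map hs (φ g) J (fun l => (hJ l).monotone) σ hsol
    convert! this using 1
    simp only [Set.mem_ofPred_eq]
    congr! 1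
    funext l
    ext i j
    simp [φ, hσ]
  intro H
  have := (isClosed_sol J).closure_subset_iff.mpr hsub
  exact this (hD H)

end

section
open Module Matrix

lemma exists_perm_of_map_eq {n : ℕ} (f g : Fin n → ℝ)
    (h : Multiset.map f Finset.univ.val = Multiset.map g Finset.univ.val) :
    ∃ e : Equiv.Perm (Fin n), ∀ i, f i = g (e i) := by
  have hc : ∀ a : ℝ, Nonempty ({i // f i = a} ≃ {i // g i = a}) := by
    intro a
    refine ⟨Fintype.equivOfCardEq ?_⟩
    have h1 := congrArg (Multiset.count a) h
    rw [Multiset.count_map, Multiset.count_map] at h1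
    rw [Fintype.card_subtype, Fintype.card_subtype, Finset.card_def, Finset.card_def,
      Finset.filter_val, Finset.filter_val]
    simpa [eq_comm] using h1
  let E : ∀ a : ℝ, {i // f i = a} ≃ {i // g i = a} := fun a => (hc a).some
  refine ⟨Equiv.ofFiberEquiv E, fun i => ?_⟩
  exact (Equiv.ofFiberEquiv_map E i).symm

lemma hermitian_diag {r : ℕ} (A : Matrix (Fin r) (Fin r) ℂ) (hA : A.IsHermitian) :
    ∃ W : Matrix (Fin r) (Fin r) ℂ, Wᴴ * W = 1 ∧
      A = W * diagonal (fun i => (hA.eigenvalues i : ℂ)) * Wᴴ := by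
  refine ⟨hA.eigenvectorUnitary, ?_, ?_⟩
  · exact Unitary.coe_star_mul_self hA.eigenvectorUnitary
  · exact hA.spectral_theorem

lemma diag_perm {r : ℕ} (W : Matrix (Fin r) (Fin r) ℂ) (u : Fin r → ℂ) (e : Equiv.Perm (Fin r)) :
    W * diagonal u * Wᴴ =
      (W.submatrix id e) * diagonal (fun i => u (e i)) * (W.submatrix id e)ᴴ := by
  rw [Matrix.conjTranspose_submatrix]
  have : diagonal (fun i => u (e i)) = (diagonal u).submatrix e e := by
    rw [Matrix.submatrix_diagonal_equiv]; rfl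
  rw [this, Matrix.submatrix_mul_equiv, Matrix.submatrix_mul_equiv, Matrix.submatrix_id_id]

lemma frame_perm {m r : ℕ} (W : Matrix (Fin m) (Fin r) ℂ) (hW : Wᴴ * W = 1)
    (e : Equiv.Perm (Fin r)) : (W.submatrix id e)ᴴ * (W.submatrix id e) = 1 := by
  rw [Matrix.conjTranspose_submatrix, ← Matrix.submatrix_mul _ _ e id e Function.bijective_id, hW]
  simp

lemma kirwan_iff {s r : ℕ} (Λ : Fin s → Fin r → ℝ) (t : ℝ) (hΛ : ∀ l, Antitone (Λ l)) :
    KirwanMem Λ t ↔ ∃ W : Fin s → Matrix (Fin r) (Fin r) ℂ, (∀ l, (W l)ᴴ * W l = 1) ∧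
      ∑ l, W l * diagonal (fun i => (Λ l i : ℂ)) * (W l)ᴴ = (t : ℂ) • 1 := by
  constructor
  · rintro ⟨-, A, hA, hsum, he⟩
    choose e he using he
    choose W hW hAW using fun l => hermitian_diag (A l) (hA l)
    refine ⟨fun l => (W l).submatrix id (e l), fun l => frame_perm _ (hW l) _, ?_⟩
    rw [← hsum]
    refine Finset.sum_congr rfl fun l _ => ?_
    have := diag_perm (W l) (fun i => ((hA l).eigenvalues i : ℂ)) (e l)
    rw [hAW l, this]
    simp only [he]
  · rintro ⟨W, hW, hsum⟩
    have hH : ∀ l, (W l * diagonal (fun i => (Λ l i : ℂ)) * (W l)ᴴ).IsHermitian := by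
      intro l
      unfold Matrix.IsHermitian
      simp only [Matrix.conjTranspose_mul, Matrix.conjTranspose_conjTranspose,
        Matrix.diagonal_conjTranspose, Matrix.mul_assoc]
      congr 3
      ext i
      simp
    refine ⟨hΛ, _, hH, hsum, fun l => ?_⟩
    apply exists_perm_of_map_eq
    have h1 := (hH l).roots_charpoly_eq_eigenvalues
    have h0 : (W l * diagonal (fun i => (Λ l i : ℂ)) * (W l)ᴴ).charpoly.roots =
        Multiset.map (fun i => (Λ l i : ℂ)) Finset.univ.val := by
      rw [Matrix.mul_assoc, Matrix.charpoly_mul_comm, Matrix.mul_assoc, hW, Matrix.mul_one,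
        Matrix.charpoly_diagonal]
      exact Polynomial.roots_multiset_prod_X_sub_C (Multiset.map (fun i => (Λ l i : ℂ)) Finset.univ.val) ▸
        congrArg Polynomial.roots (by simp [Finset.prod, Function.comp_def])
    rw [h0] at h1
    have h2 := congrArg (Multiset.map Complex.re) h1
    simpa [Multiset.map_map, Function.comp_def] using h2

lemma finrank_stepSp {r : ℕ} (H : Matrix (Fin r) (Fin r) ℂ) (hH : IsUnit H.det) (i : Fin r) :
    finrank ℂ (stepSp H i) = (i : ℕ) + 1 := by
  have hinv : H * H⁻¹ = 1 := Matrix.mul_nonsing_inv H hH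
  have hinv' : H⁻¹ * H = 1 := Matrix.nonsing_inv_mul H hH
  let E : stepSp H i ≃ₗ[ℂ] ({j : Fin r // j ≤ i} → ℂ) :=
    { toFun := fun v j => (H *ᵥ v.1) j
      map_add' := fun v w => by ext j; simp [Matrix.mulVec_add]
      map_smul' := fun c v => by ext j; simp [Matrix.mulVec_smul]
      invFun := fun w => ⟨H⁻¹ *ᵥ (fun j => if h : j ≤ i then w ⟨j, h⟩ else 0), by
        intro j hj
        rw [Matrix.mulVec_mulVec, hinv, Matrix.one_mulVec, dif_neg (not_le.mpr hj)]⟩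
      left_inv := fun v => by
        ext1
        have : (fun j => if h : j ≤ i then (H *ᵥ v.1) j else 0) = H *ᵥ v.1 := by
          ext j
          split_ifs with h
          · rfl
          · exact (v.2 j (not_le.mp h)).symm
        change H⁻¹ *ᵥ (fun j => if h : j ≤ i then (H *ᵥ v.1) j else 0) = v.1
        rw [this, Matrix.mulVec_mulVec, hinv', Matrix.one_mulVec]
      right_inv := fun w => by
        ext j
        change (H *ᵥ (H⁻¹ *ᵥ (fun j => if h : j ≤ i then w ⟨j, h⟩ else 0))) j = w j
        rw [Matrix.mulVec_mulVec, hinv, Matrix.one_mulVec, dif_pos j.2] }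
  rw [E.finrank_eq, Module.finrank_fintype_fun_eq_card, Fintype.card_subtype]
  have : (Finset.univ.filter fun k' : Fin r => k' ≤ i) = Finset.Iic i := by ext; simp
  rw [this, Fin.card_Iic]

/-- The flag attached to an invertible matrix. -/
def flagOf {r : ℕ} (H : Matrix (Fin r) (Fin r) ℂ) (hH : IsUnit H.det) : Flagg r where
  F := stepSp H
  mono := stepSp_mono H
  rank_eq := finrank_stepSp H hH

lemma isUnit_det_of_mul {r : ℕ} (A B : Matrix (Fin r) (Fin r) ℂ) (h : A * B = 1) :
    IsUnit A.det := by
  have := congrArg Matrix.det h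
  rw [Matrix.det_mul, Matrix.det_one] at this
  exact IsUnit.of_mul_eq_one _ this

/-- A frame adapted to the eigenflag has large compressed diagonal entries. -/
lemma diag_entry_ge {r d : ℕ} (W : Matrix (Fin r) (Fin r) ℂ) (hW : Wᴴ * W = 1)
    (Λ : Fin r → ℝ) (hΛ : Antitone Λ) (Q : Matrix (Fin r) (Fin d) ℂ) (hQ : Qᴴ * Q = 1)
    (k : Fin d) (m : Fin r) (hm : ∀ j, m < j → (Wᴴ * Q) j k = 0) :
    Λ m ≤ ((Qᴴ * (W * diagonal (fun i => (Λ i : ℂ)) * Wᴴ) * Q) k k).re := by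
  set Y := Wᴴ * Q with hY
  have hW' : W * Wᴴ = 1 := mul_eq_one_comm.mp hW
  have hYY : Yᴴ * Y = 1 := by
    rw [hY, Matrix.conjTranspose_mul, Matrix.conjTranspose_conjTranspose, Matrix.mul_assoc,
      ← Matrix.mul_assoc W, hW', Matrix.one_mul, hQ]
  have h1 : Qᴴ * (W * diagonal (fun i => (Λ i : ℂ)) * Wᴴ) * Q =
      Yᴴ * diagonal (fun i => (Λ i : ℂ)) * Y := by
    rw [hY, Matrix.conjTranspose_mul, Matrix.conjTranspose_conjTranspose]
    simp only [Matrix.mul_assoc]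
  rw [h1]
  have hsq : ∀ j, star (Y j k) * Y j k = ((‖Y j k‖ ^ 2 : ℝ) : ℂ) := fun j => by
    simpa using Complex.conj_mul' (Y j k)
  have h2 : (Yᴴ * diagonal (fun i => (Λ i : ℂ)) * Y) k k =
      ((∑ j, Λ j * ‖Y j k‖ ^ 2 : ℝ) : ℂ) := by
    rw [Matrix.mul_apply, Complex.ofReal_sum]
    refine Finset.sum_congr rfl fun j _ => ?_
    rw [Matrix.mul_diagonal, Matrix.conjTranspose_apply, Complex.ofReal_mul, ← hsq]
    ring
  have h3 : ∑ j, ‖Y j k‖ ^ 2 = 1 := by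
    have := congrFun (congrFun hYY k) k
    rw [Matrix.mul_apply, Matrix.one_apply_eq] at this
    simp only [Matrix.conjTranspose_apply, hsq] at this
    exact_mod_cast this
  rw [h2, Complex.ofReal_re]
  calc Λ m = ∑ j, Λ m * ‖Y j k‖ ^ 2 := by rw [← Finset.mul_sum, h3, mul_one]
    _ ≤ _ := by
      refine Finset.sum_le_sum fun j _ => ?_
      by_cases hj : m < j
      · rw [hm j hj]; simp
      · exact mul_le_mul_of_nonneg_right (hΛ (not_lt.mp hj)) (by positivity)

lemma necessity {s r : ℕ} (hs : 0 < s) (Λ : Fin s → Fin r → ℝ) (t : ℝ)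
    (hΛ : ∀ l, Antitone (Λ l)) (hk : KirwanMem Λ t) :
    TT Λ = (r : ℝ) * t ∧ ∀ (d : ℕ) (J : Fin s → Fin d → Fin r), (∀ l, StrictMono (J l)) →
      Intersecting J → TJ J Λ ≤ (d : ℝ) * t := by
  obtain ⟨W, hW, hsum⟩ := (kirwan_iff Λ t hΛ).mp hk
  constructor
  · have := congrArg Matrix.trace hsum
    rw [Matrix.trace_sum] at this
    have h1 : ∀ l, (W l * diagonal (fun i => (Λ l i : ℂ)) * (W l)ᴴ).trace =
        ((∑ i, Λ l i : ℝ) : ℂ) := by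
      intro l
      rw [Matrix.trace_mul_comm, ← Matrix.mul_assoc, hW, Matrix.one_mul, Matrix.trace_diagonal]
      simp
    simp only [h1] at this
    rw [Matrix.trace_smul, Matrix.trace_one, ← Complex.ofReal_sum] at this
    have h2 : TT Λ = t * r := by
      unfold TT
      simp only [smul_eq_mul, Fintype.card_fin] at this
      exact_mod_cast this
    rw [h2, mul_comm]
  · intro d J hJ hI
    have hWu : ∀ l, IsUnit ((W l)ᴴ).det := fun l => isUnit_det_of_mul _ _ (hW l)
    obtain ⟨V, hV, hd⟩ := hI (fun l => flagOf ((W l)ᴴ) (hWu l))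
    obtain ⟨Q, hQ, hQQ, hv⟩ := sol_of_subspace (fun l => (W l)ᴴ) J V hV hd
    let l0 : Fin s := ⟨0, hs⟩
    have h1 : ∀ l, ∑ k, Λ l (J l k) ≤
        (((W l * diagonal (fun i => (Λ l i : ℂ)) * (W l)ᴴ) * (Q l0 * (Q l0)ᴴ)).trace).re := by
      intro l
      rw [hQQ l0 l, ← Matrix.mul_assoc, Matrix.trace_mul_comm, ← Matrix.mul_assoc, Matrix.trace,
        Complex.re_sum]
      exact Finset.sum_le_sum fun k _ =>
        diag_entry_ge (W l) (hW l) (Λ l) (hΛ l) (Q l) (hQ l) k (J l k) (hv l k)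
    calc TJ J Λ ≤ ∑ l, (((W l * diagonal (fun i => (Λ l i : ℂ)) * (W l)ᴴ) *
          (Q l0 * (Q l0)ᴴ)).trace).re := Finset.sum_le_sum fun l _ => h1 l
      _ = (((t : ℂ) • (1 : Matrix (Fin r) (Fin r) ℂ) * (Q l0 * (Q l0)ᴴ)).trace).re := by
        rw [← hsum, Finset.sum_mul, Matrix.trace_sum, Complex.re_sum]
      _ = (d : ℝ) * t := by
        rw [Matrix.smul_mul, Matrix.one_mul, Matrix.trace_smul, Matrix.trace_mul_comm, hQ,
          Matrix.trace_one]
        simp [mul_comm]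

end

section
open Module Matrix

lemma exists_lead {r : ℕ} (v : Fin r → ℂ) (hv : v ≠ 0) :
    ∃ p, v p ≠ 0 ∧ ∀ i, p < i → v i = 0 := by
  obtain ⟨i, hi⟩ := Function.ne_iff.mp hv
  obtain ⟨p, hp1, hp2⟩ := (Finset.univ.filter fun i => v i ≠ 0).exists_maximal
    ⟨i, by simpa using hi⟩
  refine ⟨p, by simpa using hp1, fun i hi => ?_⟩
  by_contra h
  exact absurd (hp2 (by simpa using h) hi.le) (not_le.mpr hi)

/-- A form of the Bruhat decomposition. -/
lemma exists_bruhat {r : ℕ} (Y : Matrix (Fin r) (Fin r) ℂ) (hY : IsUnit Y.det) :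
    ∃ (R : Matrix (Fin r) (Fin r) ℂ) (π : Equiv.Perm (Fin r)),
      (∀ j, R j j = 1) ∧ (∀ i j, j < i → R i j = 0) ∧
      (∀ j, (Y * R) (π j) j ≠ 0) ∧ (∀ i j, π j < i → (Y * R) i j = 0) := by
  let S : Fin r → Set (Fin r → ℂ) := fun j => {x | x j = 1 ∧ ∀ m, j < m → x m = 0}
  have hS : ∀ j, ∀ x ∈ S j, Y *ᵥ x ≠ 0 := by
    intro j x hx h0
    have h1 : Y⁻¹ *ᵥ (Y *ᵥ x) = x := by
      rw [Matrix.mulVec_mulVec, Matrix.nonsing_inv_mul Y hY, Matrix.one_mulVec]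
    rw [h0, Matrix.mulVec_zero] at h1
    have := hx.1
    rw [← h1] at this
    simp at this
  have hmin : ∀ j, ∃ x p, x ∈ S j ∧ (Y *ᵥ x) p ≠ 0 ∧ (∀ i, p < i → (Y *ᵥ x) i = 0) ∧
      ∀ x' ∈ S j, ∀ p', (∀ i, p' < i → (Y *ᵥ x') i = 0) → p ≤ p' := by
    intro j
    let T : Set (Fin r) := {p | ∃ x ∈ S j, (∀ i, p < i → (Y *ᵥ x) i = 0)}
    have hT : T.Nonempty := by
      have hx : (Pi.single j 1 : Fin r → ℂ) ∈ S j :=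
        ⟨by simp, fun m hm => by simp [hm.ne']⟩
      obtain ⟨p, -, hp⟩ := exists_lead _ (hS j _ hx)
      exact ⟨p, _, hx, hp⟩
    obtain ⟨p, ⟨x, hx, hp⟩, hm⟩ := T.toFinite.exists_minimal hT
    have hm' : ∀ x' ∈ S j, ∀ p', (∀ i, p' < i → (Y *ᵥ x') i = 0) → p ≤ p' := by
      intro x' hx' p' hp'
      by_contra hlt
      exact hlt (hm ⟨x', hx', hp'⟩ (not_le.mp hlt).le)
    refine ⟨x, p, hx, ?_, hp, hm'⟩
    obtain ⟨q, hq1, hq2⟩ := exists_lead _ (hS j _ hx)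
    have h1 := hm' x hx q hq2
    have h2 : q ≤ p := by
      by_contra h
      exact hq1 (hp q (not_le.mp h))
    rwa [le_antisymm h1 h2]
  choose x p hx hp1 hp2 hp3 using hmin
  have hne : ∀ j j', j < j' → p j ≠ p j' := by
    intro j j' hjj h
    let c := (Y *ᵥ x j') (p j) / (Y *ᵥ x j) (p j)
    let x'' := x j' - c • x j
    have hx'' : x'' ∈ S j' := by
      refine ⟨?_, fun m hm => ?_⟩
      · simp [x'', (hx j').1, (hx j).2 j' hjj]
      · simp [x'', (hx j').2 m hm, (hx j).2 m (hjj.trans hm)]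
    have hz : ∀ i, p j ≤ i → (Y *ᵥ x'') i = 0 := by
      intro i hi
      simp only [x'', Matrix.mulVec_sub, Matrix.mulVec_smul, Pi.sub_apply, Pi.smul_apply,
        smul_eq_mul]
      rcases hi.eq_or_lt with rfl | hi
      · simp only [c]
        rw [div_mul_cancel₀ _ (hp1 j), sub_self]
      · rw [hp2 j i hi, hp2 j' i (h ▸ hi)]; simp
    obtain ⟨q, hq1, hq2⟩ := exists_lead _ (hS j' _ hx'')
    have h1 := hp3 j' x'' hx'' q hq2
    exact hq1 (hz q (h ▸ h1))
  have hinj : Function.Injective p := by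
    intro j j' h
    rcases lt_trichotomy j j' with hlt | heq | hgt
    · exact absurd h (hne _ _ hlt)
    · exact heq
    · exact absurd h.symm (hne _ _ hgt)
  refine ⟨Matrix.of fun i j => x j i, Equiv.ofBijective p (Finite.injective_iff_bijective.mp hinj),
    fun j => (hx j).1, fun i j h => (hx j).2 i h, fun j => hp1 j, fun i j h => hp2 j i h⟩

lemma abel_ineq {r : ℕ} (u μ : Fin r → ℝ) (t : ℝ) (hu : Monotone u)
    (hk : ∀ k : ℕ, k < r → ∑ m ∈ Finset.univ.filter (fun m : Fin r => (m : ℕ) < k), μ m ≤ k * t) (htot : ∑ m, μ m = r * t) :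
    t * ∑ m, u m ≤ ∑ m, μ m * u m := by
  let u' : ℕ → ℝ := fun i => if h : i < r then u ⟨i, h⟩ else 0
  let ν : ℕ → ℝ := fun i => if h : i < r then μ ⟨i, h⟩ - t else 0
  have hpart : ∀ k ≤ r, ∑ i ∈ Finset.range k, ν i = (∑ m ∈ Finset.univ.filter (fun m : Fin r => (m : ℕ) < k), μ m) - k * t := by
    intro k hkr
    have h1 : ∑ i ∈ Finset.range k, ν i = ∑ m ∈ Finset.univ.filter (fun m : Fin r => (m : ℕ) < k), (μ m - t) := by
      symm
      refine Finset.sum_bij (fun m _ => (m : ℕ)) ?_ ?_ ?_ ?_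
      · intro m hm; simpa using hm
      · intro a _ b _ h; exact Fin.ext h
      · intro b hb
        have hb' := Finset.mem_range.mp hb
        exact ⟨⟨b, by omega⟩, by simpa using hb', rfl⟩
      · intro m hm
        simp [ν]
    rw [h1, Finset.sum_sub_distrib, Finset.sum_const]
    have : (Finset.univ.filter fun m : Fin r => (m : ℕ) < k).card = k := by
      rw [Fin.card_filter_val_lt]; simpa using hkr
    rw [this]; simp
  have htotal : ∑ i ∈ Finset.range r, ν i = 0 := by
    rw [hpart r le_rfl]
    have : (Finset.univ.filter fun m : Fin r => (m : ℕ) < r) = Finset.univ := by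
      ext m; simp
    rw [this, htot]; ring
  have hab := Finset.sum_range_by_parts u' ν r
  rw [htotal] at hab
  have hle : ∑ i ∈ Finset.range (r - 1), (u' (i + 1) - u' i) • ∑ i ∈ Finset.range (i + 1), ν i ≤ 0 := by
    refine Finset.sum_nonpos fun i hi => ?_
    have hi' := Finset.mem_range.mp hi
    have h1 : 0 ≤ u' (i + 1) - u' i := by
      simp only [u']
      rw [dif_pos (by omega), dif_pos (by omega), sub_nonneg]
      exact hu (by simp [Fin.le_def])
    have h2 : ∑ i ∈ Finset.range (i + 1), ν i ≤ 0 := by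
      rw [hpart _ (by omega)]
      have := hk (i + 1) (by omega)
      linarith
    exact mul_nonpos_of_nonneg_of_nonpos h1 h2
  have hnn : 0 ≤ ∑ i ∈ Finset.range r, u' i • ν i := by
    rw [hab]; simp only [smul_zero]; linarith
  rw [Finset.sum_range] at hnn
  have : ∑ i : Fin r, u' i • ν i = ∑ m, μ m * u m - t * ∑ m, u m := by
    rw [Finset.mul_sum, ← Finset.sum_sub_distrib]
    refine Finset.sum_congr rfl fun i _ => ?_
    simp [u', ν]; ring
  linarith

/-- Horn's inequalities for generic flags give semistability. -/
lemma semistable {s r : ℕ} (Λ : Fin s → Fin r → ℝ) (t : ℝ)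
    (H : Fin s → Matrix (Fin r) (Fin r) ℂ) (hH : ∀ l, IsUnit (H l).det)
    (hgen : ∀ (d : ℕ) (J : Fin s → Fin d → Fin r), (∀ l, StrictMono (J l)) →
      ∀ V : Submodule ℂ (Fin r → ℂ), finrank ℂ V = d →
      (∀ (l : Fin s) (k : Fin d), (k : ℕ) + 1 ≤ finrank ℂ ↥(V ⊓ stepSp (H l) (J l k))) →
      Intersecting J)
    (htot : TT Λ = r * t)
    (hhorn : ∀ (d : ℕ), 1 ≤ d → d < r →
      ∀ J : Fin s → Fin d → Fin r, (∀ l, StrictMono (J l)) → Intersecting J →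
        TJ J Λ ≤ (d : ℝ) * t)
    (U : Matrix (Fin r) (Fin r) ℂ) (hU : Uᴴ * U = 1) (u : Fin r → ℝ) (hu : Monotone u) :
    ∃ (R : Fin s → Matrix (Fin r) (Fin r) ℂ) (π : Fin s → Equiv.Perm (Fin r)),
      (∀ l j, R l j j = 1) ∧ (∀ l i j, j < i → R l i j = 0) ∧
      (∀ l j, (Uᴴ * (H l)⁻¹ * R l) (π l j) j ≠ 0) ∧
      (∀ l i j, π l j < i → (Uᴴ * (H l)⁻¹ * R l) i j = 0) ∧
      t * ∑ m, u m ≤ ∑ l, ∑ j, Λ l j * u (π l j) := by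
  have hU' : U * Uᴴ = 1 := mul_eq_one_comm.mp hU
  have hUu : IsUnit (Uᴴ).det := isUnit_det_of_mul _ _ hU
  have hY : ∀ l, IsUnit (Uᴴ * (H l)⁻¹).det := fun l => by
    rw [Matrix.det_mul]
    exact hUu.mul (Matrix.isUnit_nonsing_inv_det _ (hH l))
  choose R π hR1 hR2 hB1 hB2 using fun l => exists_bruhat (Uᴴ * (H l)⁻¹) (hY l)
  refine ⟨R, π, hR1, hR2, hB1, hB2, ?_⟩
  have hRdet : ∀ l, (R l).det = 1 := fun l => by
    rw [Matrix.det_of_isUpperTriangular (fun i j h => hR2 l i j h)]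
    simp [hR1]
  let μ : Fin r → ℝ := fun m => ∑ l, Λ l ((π l).symm m)
  have hsum : ∑ l, ∑ j, Λ l j * u (π l j) = ∑ m, μ m * u m := by
    simp only [μ, Finset.sum_mul]
    conv_rhs => rw [Finset.sum_comm]
    refine Finset.sum_congr rfl fun l _ => ?_
    rw [← Equiv.sum_comp (π l) (fun m => Λ l ((π l).symm m) * u m)]
    simp
  rw [hsum]
  refine abel_ineq u μ t hu ?_ ?_
  · intro k hkr
    rcases Nat.eq_zero_or_pos k with rfl | hk0
    · simp
    let P : Fin s → Finset (Fin r) := fun l => Finset.univ.filter fun j => ((π l j : Fin r) : ℕ) < k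
    have hP : ∀ l, (P l).card = k := fun l => by
      have h1 : (P l).map (π l).toEmbedding = Finset.univ.filter fun m : Fin r => (m : ℕ) < k := by
        ext m
        simp only [P, Finset.mem_map_equiv, Finset.mem_filter, Finset.mem_univ, true_and,
          Equiv.apply_symm_apply]
      rw [← Finset.card_map (π l).toEmbedding, h1, Fin.card_filter_val_lt]
      simpa using hkr.le
    let J : Fin s → Fin k → Fin r := fun l => (P l).orderEmbOfFin (hP l)
    have hJ : ∀ l, StrictMono (J l) := fun l => ((P l).orderEmbOfFin (hP l)).strictMono
    have hJm : ∀ l a, ((π l (J l a) : Fin r) : ℕ) < k := fun l a => by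
      have := (P l).orderEmbOfFin_mem (hP l) a
      exact (Finset.mem_filter.mp this).2
    have hTJ : ∑ m ∈ Finset.univ.filter (fun m : Fin r => (m : ℕ) < k), μ m = TJ J Λ := by
      simp only [μ, TJ]
      rw [Finset.sum_comm]
      refine Finset.sum_congr rfl fun l _ => ?_
      have h1 : ∑ a, Λ l (J l a) = ∑ j ∈ P l, Λ l j := by
        conv_rhs => rw [← Finset.image_orderEmbOfFin_univ (P l) (hP l)]
        rw [Finset.sum_image (fun a _ b _ h => ((P l).orderEmbOfFin (hP l)).injective h)]
      rw [h1]
      symm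
      refine Finset.sum_bij (fun j _ => π l j) ?_ ?_ ?_ ?_
      · intro j hj; simpa [P] using hj
      · intro a _ b _ h; exact (π l).injective h
      · intro m hm
        exact ⟨(π l).symm m, by simpa [P] using hm, by simp⟩
      · intro j _; simp
    rw [hTJ]
    refine hhorn k hk0 hkr J hJ ?_
    let k' : Fin r := ⟨k - 1, by omega⟩
    refine hgen k J hJ (stepSp Uᴴ k') ?_ ?_
    · rw [finrank_stepSp _ hUu]; simp [k']; omega
    · intro l a
      let N := (H l)⁻¹ * R l
      have hN : IsUnit N.det := by
        rw [Matrix.det_mul, hRdet, mul_one]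
        exact Matrix.isUnit_nonsing_inv_det _ (hH l)
      have hHN : H l * N = R l := by
        simp only [N]
        rw [← Matrix.mul_assoc, Matrix.mul_nonsing_inv _ (hH l), Matrix.one_mul]
      refine finrank_of_frame (N.submatrix id (J l)) (N⁻¹.submatrix (J l) id) ?_ _ a ?_
      · rw [← Matrix.submatrix_mul _ _ (J l) id (J l) Function.bijective_id,
          Matrix.nonsing_inv_mul _ hN]
        exact Matrix.submatrix_one _ (hJ l).injective
      · intro b hb
        refine ⟨fun i hi => ?_, ?_⟩
        · have h2 := hB2 l i (J l b) (by
            have := hJm l b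
            simp only [Fin.lt_def, k'] at hi ⊢
            omega)
          rw [Matrix.mul_assoc] at h2
          exact h2
        · refine stepSp_mono (H l) ((hJ l).monotone hb) fun i hi => ?_
          have h2 := hR2 l i (J l b) hi
          rw [← hHN] at h2
          exact h2
  · rw [← htot]
    simp only [μ, TT]
    rw [Finset.sum_comm]
    exact Finset.sum_congr rfl fun l _ => Equiv.sum_comp (π l).symm (Λ l)

end

section
open Module Matrix

/-- Symmetrized Cauchy-Binet formula. -/
lemma cauchy_binet_symm {m n : Type*} [Fintype m] [Fintype n] [DecidableEq n]
    (M : Matrix n m ℂ) (N : Matrix m n ℂ) :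
    ((Fintype.card n).factorial : ℂ) * (M * N).det =
      ∑ f : n → m, (M.submatrix id f).det * (N.submatrix f id).det := by
  classical
  have h1 : (M * N).det = ∑ f : n → m, (M.submatrix id f).det * ∏ i, N (f i) i := by
    simp only [det_apply', mul_apply, Finset.prod_univ_sum, Finset.mul_sum,
      Fintype.piFinset_univ, Finset.sum_mul, Matrix.submatrix_apply, id]
    rw [Finset.sum_comm]
    refine Finset.sum_congr rfl fun f _ => Finset.sum_congr rfl fun σ _ => ?_
    rw [Finset.prod_mul_distrib, mul_assoc]
  have h2 : ∀ τ : Equiv.Perm n, (M * N).det =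
      ∑ f : n → m, (M.submatrix id f).det *
        (((Equiv.Perm.sign τ : ℤ) : ℂ) * ∏ i, (N.submatrix f id) (τ i) i) := by
    intro τ
    rw [h1]
    refine Fintype.sum_equiv (Equiv.arrowCongr τ (Equiv.refl m)) _ _ fun f => ?_
    have h3 : M.submatrix id f =
        (M.submatrix id (Equiv.arrowCongr τ (Equiv.refl m) f)).submatrix id τ := by
      ext i j; simp [Equiv.arrowCongr]
    rw [h3, Matrix.det_permute']
    simp [Equiv.arrowCongr]
    ring
  have h4 : ((Fintype.card n).factorial : ℂ) * (M * N).det =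
      ∑ τ : Equiv.Perm n, (M * N).det := by
    rw [Finset.sum_const, Finset.card_univ, Fintype.card_perm]; simp
  rw [h4]
  conv_lhs => rw [Finset.sum_congr rfl fun τ _ => h2 τ]
  rw [Finset.sum_comm]
  refine Finset.sum_congr rfl fun f _ => ?_
  rw [← Finset.mul_sum, ← det_apply']

lemma cauchy_binet_diag {m n : Type*} [Fintype m] [Fintype n] [DecidableEq m] [DecidableEq n]
    (Y : Matrix m n ℂ) (D : m → ℝ) :
    (Yᴴ * diagonal (fun i => (D i : ℂ)) * Y).det =
      ((∑ f : n → m, ‖(Y.submatrix f id).det‖ ^ 2 / ((Fintype.card n).factorial : ℝ) *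
        ∏ a, D (f a) : ℝ) : ℂ) := by
  have h := cauchy_binet_symm (Yᴴ * diagonal (fun i => (D i : ℂ))) Y
  have hf : ((Fintype.card n).factorial : ℂ) ≠ 0 := by
    exact_mod_cast Nat.factorial_ne_zero _
  apply mul_left_cancel₀ hf
  rw [h]
  push_cast
  rw [Finset.mul_sum]
  refine Finset.sum_congr rfl fun f _ => ?_
  have h1 : (Yᴴ * diagonal (fun i => (D i : ℂ))).submatrix id f =
      (Y.submatrix f id)ᴴ * diagonal (fun a => (D (f a) : ℂ)) := by
    ext i j; simp [Matrix.mul_diagonal]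
  rw [h1, Matrix.det_mul, Matrix.det_diagonal, Matrix.det_conjTranspose]
  have h2 : star (Y.submatrix f id).det * (Y.submatrix f id).det =
      (‖(Y.submatrix f id).det‖ : ℂ) ^ 2 := by
    rw [Complex.star_def, Complex.conj_mul']
  field_simp
  rw [← h2]; ring

lemma convexOn_logSumExp {ι : Type*} [Fintype ι] (a u : ι → ℝ) (ha : ∀ i, 0 ≤ a i)
    (hpos : ∀ τ : ℝ, 0 < ∑ i, a i * Real.exp (τ * u i)) :
    ConvexOn ℝ Set.univ (fun τ : ℝ => Real.log (∑ i, a i * Real.exp (τ * u i))) := by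
  refine ⟨convex_univ, fun x _ y _ p q hp hq hpq => ?_⟩
  simp only [smul_eq_mul]
  set A := Real.log (∑ i, a i * Real.exp (x * u i)) with hA
  set B := Real.log (∑ i, a i * Real.exp (y * u i)) with hB
  rw [Real.log_le_iff_le_exp (hpos _)]
  have key : ∀ i, a i * Real.exp ((p * x + q * y) * u i) ≤ Real.exp (p * A + q * B) *
      (p * (a i * Real.exp (x * u i)) / Real.exp A + q * (a i * Real.exp (y * u i)) / Real.exp B) := by
    intro i
    have h := convexOn_exp.2 (Set.mem_univ (x * u i - A)) (Set.mem_univ (y * u i - B)) hp hq hpq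
    simp only [smul_eq_mul] at h
    have h1 : (p * x + q * y) * u i =
        (p * A + q * B) + (p * (x * u i - A) + q * (y * u i - B)) := by ring
    rw [h1, Real.exp_add]
    calc _ = Real.exp (p * A + q * B) * (a i * Real.exp (p * (x * u i - A) + q * (y * u i - B))) := by
            ring
      _ ≤ Real.exp (p * A + q * B) * (a i * (p * Real.exp (x * u i - A) + q * Real.exp (y * u i - B))) := by
            gcongr
            exact ha i
      _ = _ := by
            rw [Real.exp_sub, Real.exp_sub]; ring
  refine (Finset.sum_le_sum fun i _ => key i).trans ?_
  rw [← Finset.mul_sum, Finset.sum_add_distrib, ← Finset.sum_div, ← Finset.sum_div,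
    ← Finset.mul_sum, ← Finset.mul_sum]
  rw [hA, hB, Real.exp_log (hpos x), Real.exp_log (hpos y),
    mul_div_cancel_right₀ _ (hpos x).ne', mul_div_cancel_right₀ _ (hpos y).ne', hpq, mul_one]

end

section
open Module Matrix
open scoped ComplexOrder

/-- The first `i+1` columns of `G`. -/
def colsLE {r : ℕ} (G : Matrix (Fin r) (Fin r) ℂ) (i : Fin r) :
    Matrix (Fin r) {j : Fin r // j ≤ i} ℂ :=
  G.submatrix id Subtype.val

/-- Gram determinant of the first `i+1` columns of `G` with respect to `h`. -/
noncomputable def PP {r : ℕ} (G : Matrix (Fin r) (Fin r) ℂ) (i : Fin r)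
    (h : Matrix (Fin r) (Fin r) ℂ) : ℝ :=
  ((colsLE G i)ᴴ * h * colsLE G i).det.re

/-- `U exp(x) Uᴴ`. -/
noncomputable def hh {r : ℕ} (U : Matrix (Fin r) (Fin r) ℂ) (x : Fin r → ℝ) :
    Matrix (Fin r) (Fin r) ℂ :=
  U * diagonal (fun i => (Real.exp (x i) : ℂ)) * Uᴴ

lemma PP_pos {r : ℕ} (G : Matrix (Fin r) (Fin r) ℂ) (hG : IsUnit G.det) (i : Fin r)
    (h : Matrix (Fin r) (Fin r) ℂ) (hh : h.PosDef) : 0 < PP G i h := by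
  have hinj : Function.Injective (colsLE G i).mulVec := by
    have h1 : ((G⁻¹).submatrix Subtype.val id) * colsLE G i =
        (1 : Matrix {j : Fin r // j ≤ i} {j : Fin r // j ≤ i} ℂ) := by
      rw [colsLE, ← Matrix.submatrix_mul _ _ _ id _ Function.bijective_id,
        Matrix.nonsing_inv_mul _ hG]
      exact Matrix.submatrix_one _ Subtype.val_injective
    intro x y hxy
    have := congrArg (((G⁻¹).submatrix (Subtype.val : {j : Fin r // j ≤ i} → Fin r) id).mulVec) hxy
    simpa [Matrix.mulVec_mulVec, h1] using this
  have := (hh.conjTranspose_mul_mul_same hinj).det_pos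
  exact (Complex.lt_def.mp this).1

lemma posDef_diag {r : ℕ} (U : Matrix (Fin r) (Fin r) ℂ) (hU : Uᴴ * U = 1) (y : Fin r → ℝ)
    (hy : ∀ i, 0 < y i) : (U * diagonal (fun i => (y i : ℂ)) * Uᴴ).PosDef := by
  have h1 : (diagonal (fun i => (y i : ℂ))).PosDef := by
    refine Matrix.PosDef.diagonal ?_
    intro i
    exact_mod_cast hy i
  refine h1.mul_mul_conjTranspose_same ?_
  intro a b hab
  have hU' : U * Uᴴ = 1 := mul_eq_one_comm.mp hU
  have h2 : (a ᵥ* U) ᵥ* Uᴴ = (b ᵥ* U) ᵥ* Uᴴ := congrArg (· ᵥ* Uᴴ) hab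
  simpa [Matrix.vecMul_vecMul, hU'] using h2

lemma hh_posDef {r : ℕ} (U : Matrix (Fin r) (Fin r) ℂ) (hU : Uᴴ * U = 1) (x : Fin r → ℝ) :
    (hh U x).PosDef := posDef_diag U hU _ fun _ => Real.exp_pos _

lemma hh_trace {r : ℕ} (U : Matrix (Fin r) (Fin r) ℂ) (hU : Uᴴ * U = 1) (x : Fin r → ℝ) :
    (hh U x).trace.re = ∑ i, Real.exp (x i) := by
  rw [hh, Matrix.trace_mul_comm, ← Matrix.mul_assoc, hU, Matrix.one_mul, Matrix.trace_diagonal]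
  rw [Complex.re_sum]
  simp only [Complex.ofReal_re]

lemma hh_det {r : ℕ} (U : Matrix (Fin r) (Fin r) ℂ) (hU : Uᴴ * U = 1) (x : Fin r → ℝ) :
    (hh U x).det.re = Real.exp (∑ i, x i) := by
  rw [hh, Matrix.det_mul, mul_comm, ← Matrix.det_mul, ← Matrix.mul_assoc, hU, Matrix.one_mul,
    Matrix.det_diagonal, Real.exp_sum, ← Complex.ofReal_prod, Complex.ofReal_re]

lemma PP_hh {r : ℕ} (G U : Matrix (Fin r) (Fin r) ℂ) (i : Fin r) (x : Fin r → ℝ) :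
    PP G i (hh U x) = ∑ f : {j : Fin r // j ≤ i} → Fin r,
      ‖((Uᴴ * colsLE G i).submatrix f id).det‖ ^ 2 /
        ((Fintype.card {j : Fin r // j ≤ i}).factorial : ℝ) * Real.exp (∑ a, x (f a)) := by
  have h1 : (colsLE G i)ᴴ * hh U x * colsLE G i =
      (Uᴴ * colsLE G i)ᴴ * diagonal (fun i => (Real.exp (x i) : ℂ)) * (Uᴴ * colsLE G i) := by
    simp [hh, Matrix.mul_assoc]
  rw [PP, h1, cauchy_binet_diag, Complex.ofReal_re]
  simp only [Real.exp_sum]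

lemma convex_PP {r : ℕ} (G U : Matrix (Fin r) (Fin r) ℂ) (hG : IsUnit G.det) (hU : Uᴴ * U = 1)
    (i : Fin r) (u : Fin r → ℝ) :
    ConvexOn ℝ Set.univ (fun τ : ℝ => Real.log (PP G i (hh U (τ • u)))) := by
  have h1 : ∀ τ : ℝ, PP G i (hh U (τ • u)) = ∑ f : {j : Fin r // j ≤ i} → Fin r,
      ‖((Uᴴ * colsLE G i).submatrix f id).det‖ ^ 2 /
        ((Fintype.card {j : Fin r // j ≤ i}).factorial : ℝ) * Real.exp (τ * ∑ a, u (f a)) := by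
    intro τ
    rw [PP_hh]
    simp only [Pi.smul_apply, smul_eq_mul, Finset.mul_sum]
  have h2 := convexOn_logSumExp (fun f : {j : Fin r // j ≤ i} → Fin r =>
      ‖((Uᴴ * colsLE G i).submatrix f id).det‖ ^ 2 /
        ((Fintype.card {j : Fin r // j ≤ i}).factorial : ℝ)) (fun f => ∑ a, u (f a))
      (fun f => by positivity) (fun τ => by
        rw [← h1]; exact PP_pos G hG i _ (hh_posDef U hU _))
  simpa only [h1] using h2

lemma colsLE_mul {r : ℕ} (Y R : Matrix (Fin r) (Fin r) ℂ) (hR : ∀ i j, j < i → R i j = 0)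
    (i : Fin r) :
    colsLE Y i * R.submatrix (Subtype.val : {j : Fin r // j ≤ i} → Fin r) Subtype.val =
      colsLE (Y * R) i := by
  ext a b
  have h1 : ∑ j ∈ Finset.univ.filter (fun j => j ≤ i), Y a j * R j b =
      ∑ j : {j : Fin r // j ≤ i}, Y a j * R j b :=
    Finset.sum_subtype _ (by simp) (fun j => Y a j * R j b)
  have h2 := Finset.sum_filter_add_sum_filter_not Finset.univ (fun j => j ≤ i)
      (fun j => Y a j * R j b)
  have h0 : ∑ j ∈ Finset.univ.filter (fun j => ¬ j ≤ i), Y a j * R j b = 0 := by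
    refine Finset.sum_eq_zero fun j hj => ?_
    have hj' := (Finset.mem_filter.mp hj).2
    rw [hR j b (lt_of_le_of_lt b.2 (not_le.mp hj')), mul_zero]
  rw [h0, add_zero, h1] at h2
  simp only [Matrix.mul_apply, Matrix.submatrix_apply, colsLE, id]
  exact h2

lemma det_block_ne_zero {r : ℕ} (Y R : Matrix (Fin r) (Fin r) ℂ) (π : Equiv.Perm (Fin r))
    (hR1 : ∀ i j, j < i → R i j = 0)
    (h1 : ∀ j, (Y * R) (π j) j ≠ 0) (h2 : ∀ i j, π j < i → (Y * R) i j = 0) (i : Fin r) :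
    ((colsLE Y i).submatrix (fun a : {j : Fin r // j ≤ i} => π a) id).det ≠ 0 := by
  have hmul : (colsLE Y i).submatrix (fun a : {j : Fin r // j ≤ i} => π a) id *
      R.submatrix (Subtype.val : {j : Fin r // j ≤ i} → Fin r) (Subtype.val : {j : Fin r // j ≤ i} → Fin r) =
      (Y * R).submatrix (fun a : {j : Fin r // j ≤ i} => π a) Subtype.val := by
    have := congrArg (fun M => M.submatrix (fun a : {j : Fin r // j ≤ i} => π a) id)
      (colsLE_mul Y R hR1 i)
    exact this
  have hdet : ((Y * R).submatrix (fun a : {j : Fin r // j ≤ i} => π a) Subtype.val).det ≠ 0 := by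
    have hb : ((Y * R).submatrix (fun a : {j : Fin r // j ≤ i} => π a) Subtype.val).BlockTriangular
        (fun a => π a) := by
      intro a b hab
      exact h2 _ _ hab
    have hinj : Function.Injective (fun a : {j : Fin r // j ≤ i} => π a) :=
      π.injective.comp Subtype.val_injective
    let L : LinearOrder {j : Fin r // j ≤ i} := LinearOrder.lift' (fun a => π a) hinj
    rw [@Matrix.det_of_isUpperTriangular _ _ _ _ _ _ L hb]
    exact Finset.prod_ne_zero_iff.mpr fun a _ => h1 a
  rw [← hmul, Matrix.det_mul] at hdet
  exact left_ne_zero_of_mul hdet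

lemma hh_perm {r : ℕ} (U : Matrix (Fin r) (Fin r) ℂ) (x : Fin r → ℝ) (e : Equiv.Perm (Fin r)) :
    hh U x = hh (U.submatrix id e) (x ∘ e) := by
  rw [hh, diag_perm U _ e]; rfl

/-- Lower bound for the growth of the Gram determinants. -/
lemma PP_lower {s r : ℕ} (Λ : Fin s → Fin r → ℝ) (t : ℝ)
    (H : Fin s → Matrix (Fin r) (Fin r) ℂ) (hH : ∀ l, IsUnit (H l).det)
    (hgen : ∀ (d : ℕ) (J : Fin s → Fin d → Fin r), (∀ l, StrictMono (J l)) →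
      ∀ V : Submodule ℂ (Fin r → ℂ), finrank ℂ V = d →
      (∀ (l : Fin s) (k : Fin d), (k : ℕ) + 1 ≤ finrank ℂ ↥(V ⊓ stepSp (H l) (J l k))) →
      Intersecting J)
    (htot : TT Λ = r * t)
    (hhorn : ∀ (d : ℕ), 1 ≤ d → d < r →
      ∀ J : Fin s → Fin d → Fin r, (∀ l, StrictMono (J l)) → Intersecting J →
        TJ J Λ ≤ (d : ℝ) * t)
    (U : Matrix (Fin r) (Fin r) ℂ) (hU : Uᴴ * U = 1) (u : Fin r → ℝ) :
    ∃ (σ : Fin s → Equiv.Perm (Fin r)) (a : Fin s → Fin r → ℝ), (∀ l i, 0 < a l i) ∧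
      (∀ l i, ∀ τ : ℝ, a l i * Real.exp (τ * ∑ j : {j : Fin r // j ≤ i}, u (σ l j)) ≤
        PP ((H l)⁻¹) i (hh U (τ • u))) ∧
      t * ∑ m, u m ≤ ∑ l, ∑ j, Λ l j * u (σ l j) := by
  let e := Tuple.sort u
  have hmono : Monotone (u ∘ e) := Tuple.monotone_sort u
  have hU2 : (U.submatrix id e)ᴴ * (U.submatrix id e) = 1 := by
    rw [Matrix.conjTranspose_submatrix, ← Matrix.submatrix_mul _ _ _ id _ Function.bijective_id, hU]
    exact Matrix.submatrix_one _ e.injective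
  obtain ⟨R, π, hR1, hR2, hB1, hB2, hineq⟩ :=
    semistable Λ t H hH hgen htot hhorn (U.submatrix id e) hU2 (u ∘ e) hmono
  refine ⟨fun l => (π l).trans e, fun l i =>
    ‖(((U.submatrix id e)ᴴ * colsLE ((H l)⁻¹) i).submatrix
      (fun a : {j : Fin r // j ≤ i} => π l a) id).det‖ ^ 2 /
        ((Fintype.card {j : Fin r // j ≤ i}).factorial : ℝ), ?_, ?_, ?_⟩
  · intro l i
    have h1 := det_block_ne_zero _ _ _ (hR2 l) (hB1 l) (hB2 l) i
    have h2 : colsLE ((U.submatrix id e)ᴴ * (H l)⁻¹) i =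
      (U.submatrix id e)ᴴ * colsLE ((H l)⁻¹) i := rfl
    rw [h2] at h1
    have h3 := norm_pos_iff.mpr h1
    have h4 : 0 < ((Fintype.card {j : Fin r // j ≤ i}).factorial : ℝ) := by
      exact_mod_cast Nat.factorial_pos _
    positivity
  · intro l i τ
    rw [hh_perm U _ e, PP_hh]
    have h5 := Finset.single_le_sum (s := Finset.univ)
      (f := fun f : {j : Fin r // j ≤ i} → Fin r =>
        ‖(((U.submatrix id e)ᴴ * colsLE ((H l)⁻¹) i).submatrix f id).det‖ ^ 2 /
        ((Fintype.card {j : Fin r // j ≤ i}).factorial : ℝ) *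
          Real.exp (∑ a, ((τ • u) ∘ e) (f a))) (fun f _ => by positivity)
      (Finset.mem_univ (fun a : {j : Fin r // j ≤ i} => π l a))
    refine le_trans (le_of_eq ?_) h5
    simp only [Finset.mul_sum, Function.comp, Pi.smul_apply, smul_eq_mul, Equiv.trans_apply]
  · have : ∑ m, u m = ∑ m, (u ∘ e) m := (Equiv.sum_comp e u).symm
    rw [this]
    exact hineq

end

section
open Module Matrix
open scoped ComplexOrder

lemma coercive_aux {P : Type*} [TopologicalSpace P] (K : Set P) (hK : IsCompact K)
    (g : ℝ → P → ℝ) (C : ℝ) (hc : ∀ τ, ContinuousOn (g τ) K)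
    (hconv : ∀ p ∈ K, ConvexOn ℝ Set.univ (fun τ => g τ p)) (h0 : ∀ p ∈ K, g 0 p = C)
    (hlow : ∀ p ∈ K, ∃ τ, 0 < τ ∧ C < g τ p) :
    ∃ n : ℝ, 0 < n ∧ ∀ τ, n ≤ τ → ∀ p ∈ K, C < g τ p := by
  have hmono : ∀ p ∈ K, ∀ τ₀ τ : ℝ, 0 < τ₀ → τ₀ ≤ τ → C < g τ₀ p → C < g τ p := by
    intro p hp τ₀ τ h1 h2 h3
    by_contra h4
    have hτ : 0 < τ := lt_of_lt_of_le h1 h2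
    have ha : 0 ≤ 1 - τ₀ / τ := by rw [sub_nonneg, div_le_one hτ]; exact h2
    have hb : 0 ≤ τ₀ / τ := by positivity
    have hab : (1 - τ₀ / τ) + τ₀ / τ = 1 := by ring
    have h5 := (hconv p hp).2 (Set.mem_univ 0) (Set.mem_univ τ) ha hb hab
    simp only [smul_eq_mul, mul_zero, zero_add, h0 p hp, div_mul_cancel₀ _ hτ.ne'] at h5
    have h6 : τ₀ / τ * g τ p ≤ τ₀ / τ * C := by
      gcongr
      exact not_lt.mp h4
    nlinarith
  refine hK.induction_on (p := fun s => ∃ n : ℝ, 0 < n ∧ ∀ τ, n ≤ τ → ∀ p ∈ s, p ∈ K → C < g τ p)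
    ⟨1, one_pos, by simp⟩ ?_ ?_ ?_ |>.imp ?_
  · rintro s s' hss ⟨n, hn, h⟩
    exact ⟨n, hn, fun τ hτ p hp => h τ hτ p (hss hp)⟩
  · rintro s s' ⟨n, hn, h⟩ ⟨n', hn', h'⟩
    refine ⟨max n n', lt_max_of_lt_left hn, fun τ hτ p hp => ?_⟩
    rcases hp with hp | hp
    · exact h τ ((le_max_left _ _).trans hτ) p hp
    · exact h' τ ((le_max_right _ _).trans hτ) p hp
  · intro p hp
    obtain ⟨τ, hτ, hlt⟩ := hlow p hp
    refine ⟨{q | C < g τ q}, (hc τ p hp).eventually_const_lt hlt, τ, hτ, fun τ' hτ' q hq hqK => ?_⟩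
    exact hmono q hqK τ τ' hτ hτ' hq
  · rintro n ⟨hn, h⟩
    exact ⟨hn, fun τ hτ p hp => h τ hτ p hp hp⟩

/-- The regularized Kempf-Ness functional. -/
noncomputable def Psi {s r : ℕ} (G : Fin s → Matrix (Fin r) (Fin r) ℂ) (c : Fin s → Fin r → ℝ)
    (t ε : ℝ) (h : Matrix (Fin r) (Fin r) ℂ) : ℝ :=
  ∑ l, ∑ i, c l i * Real.log (PP (G l) i h) - (t + ε) * Real.log h.det.re +
    ε * r * Real.log h.trace.re

lemma continuous_PP {r : ℕ} (G : Matrix (Fin r) (Fin r) ℂ) (i : Fin r) :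
    Continuous (PP G i) := by
  unfold PP
  exact Complex.continuous_re.comp (Continuous.matrix_det (by fun_prop))

lemma continuous_hh {r : ℕ} :
    Continuous (fun p : Matrix (Fin r) (Fin r) ℂ × (Fin r → ℝ) => hh p.1 p.2) := by
  unfold hh
  refine Continuous.mul (Continuous.mul continuous_fst ?_) continuous_fst.matrix_conjTranspose
  refine Continuous.matrix_diagonal ?_
  fun_prop

lemma PosDef_det_re {r : ℕ} {h : Matrix (Fin r) (Fin r) ℂ} (hp : h.PosDef) : 0 < h.det.re :=
  (Complex.lt_def.mp hp.det_pos).1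

lemma PosDef_trace_re {r : ℕ} (hr : 1 ≤ r) {h : Matrix (Fin r) (Fin r) ℂ} (hp : h.PosDef) :
    0 < h.trace.re := by
  have : Nonempty (Fin r) := ⟨⟨0, hr⟩⟩
  exact (Complex.lt_def.mp hp.trace_pos).1

lemma Psi_continuousOn {s r : ℕ} (hr : 1 ≤ r) (G : Fin s → Matrix (Fin r) (Fin r) ℂ)
    (hG : ∀ l, IsUnit (G l).det) (c : Fin s → Fin r → ℝ) (t ε : ℝ) :
    ContinuousOn (Psi G c t ε) {h | h.PosDef} := by
  unfold Psi
  refine ContinuousOn.add (ContinuousOn.sub ?_ ?_) ?_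
  · refine continuousOn_finsetSum _ fun l _ => continuousOn_finsetSum _ fun i _ => ?_
    exact continuousOn_const.mul ((continuous_PP (G l) i).continuousOn.log
      fun h hp => (PP_pos _ (hG l) i h hp).ne')
  · exact continuousOn_const.mul (ContinuousOn.log
      (Complex.continuous_re.comp (Continuous.matrix_det continuous_id)).continuousOn
      fun h hp => (PosDef_det_re hp).ne')
  · exact continuousOn_const.mul (ContinuousOn.log
      (Complex.continuous_re.comp (Continuous.matrix_trace continuous_id)).continuousOn
      fun h hp => (PosDef_trace_re hr hp).ne')

lemma card_le {r : ℕ} (i : Fin r) : Fintype.card {j : Fin r // j ≤ i} = i + 1 := by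
  rw [Fintype.card_subtype]
  have : (Finset.univ.filter fun j : Fin r => j ≤ i) = Finset.Iic i := by ext; simp
  rw [this, Fin.card_Iic]

lemma PP_smul {r : ℕ} (G : Matrix (Fin r) (Fin r) ℂ) (i : Fin r) (h : Matrix (Fin r) (Fin r) ℂ)
    (m : ℝ) : PP G i ((m : ℂ) • h) = m ^ (Fintype.card {j : Fin r // j ≤ i}) * PP G i h := by
  unfold PP
  rw [Matrix.mul_smul, Matrix.smul_mul, Matrix.det_smul, ← Complex.ofReal_pow, Complex.re_ofReal_mul]

lemma Psi_smul {s r : ℕ} (hr : 1 ≤ r) (Λ : Fin s → Fin r → ℝ)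
    (G : Fin s → Matrix (Fin r) (Fin r) ℂ)
    (hG : ∀ l, IsUnit (G l).det) (c : Fin s → Fin r → ℝ) (t ε : ℝ)
    (hc : ∀ l (v : Fin r → ℝ), ∑ i, c l i * ∑ j : {j : Fin r // j ≤ i}, v j = ∑ j, Λ l j * v j)
    (htot : TT Λ = r * t) (h : Matrix (Fin r) (Fin r) ℂ) (hp : h.PosDef) (m : ℝ) (hm : 0 < m) :
    Psi G c t ε ((m : ℂ) • h) = Psi G c t ε h := by
  unfold Psi
  have h1 : ∀ l, ∑ i, c l i * Real.log (PP (G l) i ((m : ℂ) • h)) =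
      (∑ j, Λ l j) * Real.log m + ∑ i, c l i * Real.log (PP (G l) i h) := by
    intro l
    have h2 := hc l (fun _ => 1)
    simp only [mul_one, Finset.sum_const, Finset.card_univ, nsmul_eq_mul] at h2
    rw [← h2, Finset.sum_mul, ← Finset.sum_add_distrib]
    refine Finset.sum_congr rfl fun i _ => ?_
    rw [PP_smul, Real.log_mul (by positivity) (PP_pos _ (hG l) i h hp).ne', Real.log_pow]
    ring
  have h3 : Real.log ((m : ℂ) • h).det.re = r * Real.log m + Real.log h.det.re := by
    rw [Matrix.det_smul, ← Complex.ofReal_pow, Complex.re_ofReal_mul,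
      Real.log_mul (by positivity) (PosDef_det_re hp).ne', Real.log_pow, Fintype.card_fin]
  have h4 : Real.log ((m : ℂ) • h).trace.re = Real.log m + Real.log h.trace.re := by
    rw [Matrix.trace_smul, smul_eq_mul, Complex.re_ofReal_mul,
      Real.log_mul (by positivity) (PosDef_trace_re hr hp).ne']
  rw [Finset.sum_congr rfl fun l _ => h1 l, h3, h4, Finset.sum_add_distrib, ← Finset.sum_mul]
  have h5 : ∑ l, ∑ j, Λ l j = r * t := htot
  rw [h5]
  ring

end

section
open Module Matrix
open scoped ComplexOrder

lemma hh_zero {r : ℕ} (U : Matrix (Fin r) (Fin r) ℂ) (hU : Uᴴ * U = 1) : hh U 0 = 1 := by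
  have hU' : U * Uᴴ = 1 := mul_eq_one_comm.mp hU
  simp [hh, hU']

lemma Psi_hh {s r : ℕ} (G : Fin s → Matrix (Fin r) (Fin r) ℂ)
    (c : Fin s → Fin r → ℝ) (t ε : ℝ) (U : Matrix (Fin r) (Fin r) ℂ) (hU : Uᴴ * U = 1)
    (x : Fin r → ℝ) (hx : ∑ i, x i = 0) :
    Psi G c t ε (hh U x) = ∑ l, ∑ i, c l i * Real.log (PP (G l) i (hh U x)) +
      ε * r * Real.log (∑ i, Real.exp (x i)) := by
  rw [Psi, hh_det U hU, hh_trace U hU, hx, Real.log_exp, mul_zero, sub_zero]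

lemma convexOn_finset_sum {ι : Type*} (S : Finset ι) (f : ι → ℝ → ℝ)
    (hf : ∀ i ∈ S, ConvexOn ℝ Set.univ (f i)) : ConvexOn ℝ Set.univ (fun τ => ∑ i ∈ S, f i τ) := by
  classical
  induction S using Finset.induction_on with
  | empty => simpa using convexOn_const (0 : ℝ) (convex_univ (𝕜 := ℝ) (E := ℝ))
  | insert a S ha ih =>
    simp only [Finset.sum_insert ha]
    exact (hf a (Finset.mem_insert_self _ _)).add
      (ih fun i hi => hf i (Finset.mem_insert_of_mem hi))

lemma Psi_convex {s r : ℕ} (hr : 1 ≤ r) (G : Fin s → Matrix (Fin r) (Fin r) ℂ)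
    (hG : ∀ l, IsUnit (G l).det)
    (c : Fin s → Fin r → ℝ) (hc0 : ∀ l i, 0 ≤ c l i) (t ε : ℝ) (hε : 0 ≤ ε)
    (U : Matrix (Fin r) (Fin r) ℂ) (hU : Uᴴ * U = 1)
    (u : Fin r → ℝ) (hu : ∑ i, u i = 0) :
    ConvexOn ℝ Set.univ (fun τ : ℝ => Psi G c t ε (hh U (τ • u))) := by
  have h1 : (fun τ : ℝ => Psi G c t ε (hh U (τ • u))) = fun τ : ℝ =>
      ∑ l, ∑ i, c l i * Real.log (PP (G l) i (hh U (τ • u))) +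
      ε * r * Real.log (∑ i, 1 * Real.exp (τ * u i)) := by
    funext τ
    rw [Psi_hh G c t ε U hU _ (by simp [← Finset.mul_sum, hu])]
    simp
  rw [h1]
  refine ConvexOn.add ?_ ?_
  · refine convexOn_finset_sum _ (fun l τ => ∑ i, c l i * Real.log (PP (G l) i (hh U (τ • u))))
      fun l _ => ?_
    refine convexOn_finset_sum _ (fun i τ => c l i * Real.log (PP (G l) i (hh U (τ • u))))
      fun i _ => ?_
    exact (convex_PP (G l) U (hG l) hU i u).smul (hc0 l i)
  · have : Nonempty (Fin r) := ⟨⟨0, hr⟩⟩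
    have h2 := convexOn_logSumExp (fun _ : Fin r => (1 : ℝ)) u (fun _ => zero_le_one)
      (fun τ => by
        simp only [one_mul]
        exact Finset.sum_pos (fun i _ => Real.exp_pos _) Finset.univ_nonempty)
    exact h2.smul (by positivity : 0 ≤ ε * (r : ℝ))

lemma Psi_lower {s r : ℕ} (hr : 1 ≤ r) (Λ : Fin s → Fin r → ℝ) (t : ℝ)
    (H : Fin s → Matrix (Fin r) (Fin r) ℂ) (hH : ∀ l, IsUnit (H l).det)
    (hgen : ∀ (d : ℕ) (J : Fin s → Fin d → Fin r), (∀ l, StrictMono (J l)) →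
      ∀ V : Submodule ℂ (Fin r → ℂ), finrank ℂ V = d →
      (∀ (l : Fin s) (k : Fin d), (k : ℕ) + 1 ≤ finrank ℂ ↥(V ⊓ stepSp (H l) (J l k))) →
      Intersecting J)
    (htot : TT Λ = r * t)
    (hhorn : ∀ (d : ℕ), 1 ≤ d → d < r →
      ∀ J : Fin s → Fin d → Fin r, (∀ l, StrictMono (J l)) → Intersecting J →
        TJ J Λ ≤ (d : ℝ) * t)
    (c : Fin s → Fin r → ℝ) (hc0 : ∀ l i, 0 ≤ c l i)
    (hc : ∀ l (v : Fin r → ℝ), ∑ i, c l i * ∑ j : {j : Fin r // j ≤ i}, v j = ∑ j, Λ l j * v j)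
    (ε : ℝ) (hε : 0 < ε)
    (U : Matrix (Fin r) (Fin r) ℂ) (hU : Uᴴ * U = 1) (u : Fin r → ℝ) (hu : ∑ i, u i = 0)
    (hu0 : u ≠ 0) (C : ℝ) :
    ∃ τ : ℝ, 0 < τ ∧ C < Psi (fun l => (H l)⁻¹) c t ε (hh U (τ • u)) := by
  obtain ⟨σ, a, ha, hlow, hineq⟩ := PP_lower Λ t H hH hgen htot hhorn U hU u
  rw [hu, mul_zero] at hineq
  obtain ⟨i₀, -, hi₀⟩ := Finset.exists_pos_of_sum_zero_of_exists_nonzero u hu (by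
    obtain ⟨i, hi⟩ := Function.ne_iff.mp hu0
    exact ⟨i, Finset.mem_univ _, hi⟩)
  have hr' : (0 : ℝ) < r := by exact_mod_cast hr
  let A := ∑ l, ∑ i, c l i * Real.log (a l i)
  have hk : 0 < ε * r * u i₀ := by positivity
  let τ := (|C - A| + 1) / (ε * r * u i₀)
  have hτ : 0 < τ := by positivity
  refine ⟨τ, hτ, ?_⟩
  rw [Psi_hh _ c t ε U hU _ (by simp [← Finset.mul_sum, hu])]
  have h1 : A + τ * ∑ l, ∑ j, Λ l j * u (σ l j) ≤
      ∑ l, ∑ i, c l i * Real.log (PP ((H l)⁻¹) i (hh U (τ • u))) := by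
    simp only [A]
    rw [Finset.mul_sum, ← Finset.sum_add_distrib]
    refine Finset.sum_le_sum fun l _ => ?_
    rw [← hc l (fun j => u (σ l j)), Finset.mul_sum, ← Finset.sum_add_distrib]
    refine Finset.sum_le_sum fun i _ => ?_
    have h2 := Real.log_le_log (mul_pos (ha l i) (Real.exp_pos _)) (hlow l i τ)
    rw [Real.log_mul (ha l i).ne' (Real.exp_pos _).ne', Real.log_exp] at h2
    have h3 := mul_le_mul_of_nonneg_left h2 (hc0 l i)
    linarith
  have h4 : τ * u i₀ ≤ Real.log (∑ i, Real.exp ((τ • u) i)) := by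
    rw [Real.le_log_iff_exp_le (Finset.sum_pos (fun i _ => Real.exp_pos _) ⟨i₀, Finset.mem_univ _⟩)]
    exact Finset.single_le_sum (f := fun i => Real.exp ((τ • u) i))
      (fun i _ => (Real.exp_pos _).le) (Finset.mem_univ i₀)
  have h5 : ε * r * (τ * u i₀) = |C - A| + 1 := by
    simp only [τ]; field_simp
  have h6 := mul_le_mul_of_nonneg_left h4 (by positivity : 0 ≤ ε * (r : ℝ))
  have h7 : 0 ≤ τ * ∑ l, ∑ j, Λ l j * u (σ l j) := mul_nonneg hτ.le hineq
  have h8 := le_abs_self (C - A)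
  linarith

lemma continuous_hh_smul {r : ℕ} (τ : ℝ) :
    Continuous (fun p : Matrix (Fin r) (Fin r) ℂ × (Fin r → ℝ) => hh p.1 (τ • p.2)) := by
  unfold hh
  refine Continuous.mul (Continuous.mul continuous_fst ?_) continuous_fst.matrix_conjTranspose
  refine Continuous.matrix_diagonal ?_
  simp only [Pi.smul_apply, smul_eq_mul]
  fun_prop

lemma posDef_eq_smul_hh {r : ℕ} (hr : 1 ≤ r) (h : Matrix (Fin r) (Fin r) ℂ) (hpd : h.PosDef) :
    ∃ (W : Matrix (Fin r) (Fin r) ℂ) (x : Fin r → ℝ) (m : ℝ), Wᴴ * W = 1 ∧ ∑ i, x i = 0 ∧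
      h = ((Real.exp m : ℝ) : ℂ) • hh W x := by
  obtain ⟨W, hW, hh1⟩ := hermitian_diag h hpd.isHermitian
  have hr' : (0 : ℝ) < r := by exact_mod_cast hr
  have hevpos : ∀ i, 0 < hpd.isHermitian.eigenvalues i := fun i => hpd.eigenvalues_pos i
  generalize hpd.isHermitian.eigenvalues = ev at hh1 hevpos
  let m := (∑ i, Real.log (ev i)) / r
  let x : Fin r → ℝ := fun i => Real.log (ev i) - m
  refine ⟨W, x, m, hW, ?_, ?_⟩
  · simp only [x, Finset.sum_sub_distrib, Finset.sum_const, Finset.card_univ,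
      Fintype.card_fin, nsmul_eq_mul, m]
    field_simp
    ring
  · have h2 : (fun i => (ev i : ℂ)) =
        ((Real.exp m : ℝ) : ℂ) • (fun i => ((Real.exp (x i) : ℝ) : ℂ)) := by
      funext i
      simp only [Pi.smul_apply, smul_eq_mul, x]
      rw [← Complex.ofReal_mul, ← Real.exp_add, add_sub_cancel, Real.exp_log (hevpos i)]
    rw [hh, ← Matrix.smul_mul, ← Matrix.mul_smul, ← Matrix.diagonal_smul, ← h2]
    exact hh1

lemma isCompact_prod_aux {r : ℕ} (B : Set (Fin r → ℝ)) (hB : IsCompact B) :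
    IsCompact ({U : Matrix (Fin r) (Fin r) ℂ | Uᴴ * U = 1} ×ˢ (B ∩ {u | ∑ i, u i = 0})) := by
  refine (isCompact_frames (Fin r) (Fin r)).prod (hB.inter_right ?_)
  exact isClosed_eq (by fun_prop) continuous_const

lemma exists_big {s r : ℕ} (hr : 1 ≤ r)
    (G : Fin s → Matrix (Fin r) (Fin r) ℂ) (hG : ∀ l, IsUnit (G l).det)
    (c : Fin s → Fin r → ℝ) (hc0 : ∀ l i, 0 ≤ c l i) (t ε : ℝ) (hε : 0 < ε)
    (hlow : ∀ U : Matrix (Fin r) (Fin r) ℂ, Uᴴ * U = 1 → ∀ u : Fin r → ℝ, ∑ i, u i = 0 → u ≠ 0 →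
      ∀ C : ℝ, ∃ τ : ℝ, 0 < τ ∧ C < Psi G c t ε (hh U (τ • u))) :
    ∃ n : ℝ, 0 < n ∧ ∀ τ, n ≤ τ → ∀ U : Matrix (Fin r) (Fin r) ℂ, Uᴴ * U = 1 →
      ∀ u : Fin r → ℝ, ‖u‖ = 1 → ∑ i, u i = 0 →
        Psi G c t ε 1 < Psi G c t ε (hh U (τ • u)) := by
  have key := coercive_aux
    ({U : Matrix (Fin r) (Fin r) ℂ | Uᴴ * U = 1} ×ˢ
      (Metric.sphere (0 : Fin r → ℝ) 1 ∩ {u | ∑ i, u i = 0}))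
    (isCompact_prod_aux _ (isCompact_sphere 0 1))
    (fun τ p => Psi G c t ε (hh p.1 (τ • p.2))) (Psi G c t ε 1) ?_ ?_ ?_ ?_
  · obtain ⟨n, hn, h⟩ := key
    exact ⟨n, hn, fun τ hτ U hU u hu1 hu0 => h τ hτ (U, u) ⟨hU, by simpa using hu1, hu0⟩⟩
  · intro τ
    refine (Psi_continuousOn hr G hG c t ε).comp (continuous_hh_smul τ).continuousOn ?_
    rintro ⟨U, u⟩ ⟨hU, -⟩
    exact hh_posDef U hU _
  · rintro ⟨U, u⟩ ⟨hU, hu, hu0⟩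
    exact Psi_convex hr G hG c hc0 t ε hε.le U hU u hu0
  · rintro ⟨U, u⟩ ⟨hU, hu, hu0⟩
    have : hh U ((0 : ℝ) • u) = 1 := by rw [zero_smul]; exact hh_zero U hU
    simp only [this]
  · rintro ⟨U, u⟩ ⟨hU, hu, hu0⟩
    refine hlow U hU u hu0 ?_ _
    rintro rfl
    simp at hu

lemma exists_min_aux {s r : ℕ} (hr : 1 ≤ r) (Λ : Fin s → Fin r → ℝ) (t : ℝ)
    (G : Fin s → Matrix (Fin r) (Fin r) ℂ) (hG : ∀ l, IsUnit (G l).det)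
    (htot : TT Λ = r * t)
    (c : Fin s → Fin r → ℝ) (hc0 : ∀ l i, 0 ≤ c l i)
    (hc : ∀ l (v : Fin r → ℝ), ∑ i, c l i * ∑ j : {j : Fin r // j ≤ i}, v j = ∑ j, Λ l j * v j)
    (ε : ℝ) (hε : 0 < ε)
    (hlow : ∀ U : Matrix (Fin r) (Fin r) ℂ, Uᴴ * U = 1 → ∀ u : Fin r → ℝ, ∑ i, u i = 0 → u ≠ 0 →
      ∀ C : ℝ, ∃ τ : ℝ, 0 < τ ∧ C < Psi G c t ε (hh U (τ • u))) :
    ∃ (U : Matrix (Fin r) (Fin r) ℂ) (x : Fin r → ℝ), Uᴴ * U = 1 ∧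
      ∀ h : Matrix (Fin r) (Fin r) ℂ, h.PosDef →
        Psi G c t ε (hh U x) ≤ Psi G c t ε h := by
  obtain ⟨n, hn, hbig⟩ := exists_big hr G hG c hc0 t ε hε hlow
  have hcont : ContinuousOn (fun p : Matrix (Fin r) (Fin r) ℂ × (Fin r → ℝ) =>
      Psi G c t ε (hh p.1 p.2)) ({U : Matrix (Fin r) (Fin r) ℂ | Uᴴ * U = 1} ×ˢ
      (Metric.closedBall (0 : Fin r → ℝ) n ∩ {u | ∑ i, u i = 0})) := by
    refine (Psi_continuousOn hr G hG c t ε).comp continuous_hh.continuousOn ?_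
    rintro ⟨U, u⟩ ⟨hU, -⟩
    exact hh_posDef U hU _
  obtain ⟨⟨U₀, x₀⟩, ⟨hU₀, -⟩, hmin⟩ :=
    (isCompact_prod_aux _ (isCompact_closedBall (0 : Fin r → ℝ) n)).exists_isMinOn
    ⟨(1, 0), by simp, by simp [hn.le], by simp⟩ hcont
  have hmin' : ∀ U : Matrix (Fin r) (Fin r) ℂ, Uᴴ * U = 1 → ∀ x : Fin r → ℝ, ∑ i, x i = 0 →
      ‖x‖ ≤ n → Psi G c t ε (hh U₀ x₀) ≤ Psi G c t ε (hh U x) := fun U hU x hx hxn =>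
    isMinOn_iff.mp hmin (U, x) ⟨hU, by simpa using hxn, hx⟩
  have hC : Psi G c t ε (hh U₀ x₀) ≤ Psi G c t ε 1 := by
    have := hmin' 1 (by simp) 0 (by simp) (by simp [hn.le])
    rwa [hh_zero 1 (by simp)] at this
  refine ⟨U₀, x₀, hU₀, fun h hpd => ?_⟩
  obtain ⟨W, x, m, hW, hx, rfl⟩ := posDef_eq_smul_hh hr h hpd
  rw [Psi_smul hr Λ G hG c t ε hc htot _ (hh_posDef W hW x) _ (Real.exp_pos _)]
  by_cases hxn : ‖x‖ ≤ n
  · exact hmin' W hW x hx hxn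
  · push Not at hxn
    have hx0 : ‖x‖ ≠ 0 := (hn.trans hxn).ne'
    have h3 := hbig ‖x‖ hxn.le W hW (‖x‖⁻¹ • x) (by
      rw [norm_smul, norm_inv, norm_norm, inv_mul_cancel₀ hx0]) (by
      simp [← Finset.mul_sum, hx])
    rw [smul_smul, mul_inv_cancel₀ hx0, one_smul] at h3
    exact hC.trans h3.le

end

section
open Module Matrix
open scoped ComplexOrder

lemma hasDerivAt_det_one_add {n : Type*} [Fintype n] [DecidableEq n] (M : Matrix n n ℂ) :
    HasDerivAt (fun τ : ℝ => (1 + (τ : ℂ) • M).det.re) M.trace.re 0 := by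
  let p : Polynomial ℂ := det (1 + (Polynomial.X : Polynomial ℂ) • M.map Polynomial.C)
  have hp : ∀ z : ℂ, p.eval z = (1 + z • M).det := by
    intro z
    simp only [p]
    rw [← Polynomial.coe_evalRingHom, RingHom.map_det]
    congr 1
    ext i j
    by_cases hij : i = j
    · subst hij; simp; ring
    · simp [hij]; ring
  have h1 := p.hasDerivAt ((0 : ℝ) : ℂ)
  have h2 : p.derivative.eval ((0 : ℝ) : ℂ) = M.trace := by
    rw [Complex.ofReal_zero]
    exact Matrix.derivative_det_one_add_X_smul M
  rw [h2] at h1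
  have h3 := h1.real_of_complex
  simpa only [hp] using h3

lemma posDef_small {r : ℕ} (X : Matrix (Fin r) (Fin r) ℂ) (hX : X.IsHermitian) :
    ∀ᶠ τ : ℝ in nhds 0, (1 + (τ : ℂ) • X).PosDef := by
  obtain ⟨W, hW, hXW⟩ := hermitian_diag X hX
  have hW' : W * Wᴴ = 1 := mul_eq_one_comm.mp hW
  have h1 : ∀ i, ∀ᶠ τ in nhds (0 : ℝ), 0 < 1 + τ * hX.eigenvalues i := by
    intro i
    have hc : Continuous (fun τ : ℝ => 1 + τ * hX.eigenvalues i) := by fun_prop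
    exact hc.continuousAt.eventually_const_lt (by simp)
  filter_upwards [Filter.eventually_all.mpr h1] with τ hτ
  have h2 := posDef_diag W hW _ hτ
  have h3 : W * diagonal (fun i => ((1 + τ * hX.eigenvalues i : ℝ) : ℂ)) * Wᴴ =
      1 + (τ : ℂ) • X := by
    have h4 : diagonal (fun i => ((1 + τ * hX.eigenvalues i : ℝ) : ℂ)) =
        1 + (τ : ℂ) • diagonal (fun i => (hX.eigenvalues i : ℂ)) := by
      rw [← Matrix.diagonal_one, ← Matrix.diagonal_smul, Matrix.diagonal_add]
      congr 1
      funext i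
      simp
    rw [h4, Matrix.mul_add, Matrix.add_mul, Matrix.mul_one, hW', Matrix.mul_smul, Matrix.smul_mul]
    conv_rhs => rw [hXW]
  rwa [h3] at h2

lemma exists_qr {r : ℕ} (A : Matrix (Fin r) (Fin r) ℂ) (hA : IsUnit A.det) :
    ∃ Q T : Matrix (Fin r) (Fin r) ℂ, Qᴴ * Q = 1 ∧ (∀ i j, j < i → T i j = 0) ∧ A * T = Q := by
  have hAi : IsUnit (A⁻¹).det := Matrix.isUnit_nonsing_inv_det _ hA
  obtain ⟨Q, hQ, hQK⟩ := exists_adapted r (fun k => stepSp A⁻¹ k) (fun k => by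
    rw [finrank_stepSp _ hAi])
  refine ⟨Q, A⁻¹ * Q, hQ, fun i j hij => hQK j i hij, ?_⟩
  rw [← Matrix.mul_assoc, Matrix.mul_nonsing_inv _ hA, Matrix.one_mul]

lemma deriv_log_PP {r : ℕ} (G g Q T : Matrix (Fin r) (Fin r) ℂ)
    (hQ : Qᴴ * Q = 1) (hT : ∀ i j, j < i → T i j = 0) (hA : g * G * T = Q)
    (X : Matrix (Fin r) (Fin r) ℂ) (i : Fin r) :
    HasDerivAt (fun τ : ℝ => Real.log (PP G i (gᴴ * (1 + (τ : ℂ) • X) * g)))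
      (∑ j : {j : Fin r // j ≤ i}, ((Qᴴ * X * Q) j j).re) 0 := by
  let Ti := T.submatrix (Subtype.val : {j : Fin r // j ≤ i} → Fin r)
    (Subtype.val : {j : Fin r // j ≤ i} → Fin r)
  have h1 : g * colsLE G i * Ti = colsLE Q i := by
    rw [← hA, ← colsLE_mul (g * G) T hT i]
    rfl
  have hQi : (colsLE Q i)ᴴ * colsLE Q i = 1 := by
    rw [colsLE, Matrix.conjTranspose_submatrix,
      ← Matrix.submatrix_mul _ _ _ id _ Function.bijective_id, hQ]
    exact Matrix.submatrix_one _ Subtype.val_injective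
  have h2 : ∀ τ : ℝ, Tiᴴ * ((colsLE G i)ᴴ * (gᴴ * (1 + (τ : ℂ) • X) * g) * colsLE G i) * Ti =
      1 + (τ : ℂ) • ((colsLE Q i)ᴴ * X * colsLE Q i) := by
    intro τ
    have h3 : Tiᴴ * ((colsLE G i)ᴴ * (gᴴ * (1 + (τ : ℂ) • X) * g) * colsLE G i) * Ti =
        (g * colsLE G i * Ti)ᴴ * (1 + (τ : ℂ) • X) * (g * colsLE G i * Ti) := by
      simp only [Matrix.conjTranspose_mul, Matrix.mul_assoc]
    rw [h3, h1, Matrix.mul_add, Matrix.add_mul, Matrix.mul_one, hQi, Matrix.mul_smul,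
      Matrix.smul_mul]
  have h4 : ∀ τ : ℝ, ‖Ti.det‖ ^ 2 * PP G i (gᴴ * (1 + (τ : ℂ) • X) * g) =
      (1 + (τ : ℂ) • ((colsLE Q i)ᴴ * X * colsLE Q i)).det.re := by
    intro τ
    have h9 : ∀ D : ℂ, (starRingEnd ℂ) Ti.det * D * Ti.det = ((‖Ti.det‖ ^ 2 : ℝ) : ℂ) * D := by
      intro D
      rw [mul_right_comm, Complex.conj_mul', Complex.ofReal_pow]
    rw [← h2 τ, Matrix.det_mul, Matrix.det_mul, Matrix.det_conjTranspose, Complex.star_def, h9,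
      Complex.re_ofReal_mul]
    rfl
  have hT0 : ‖Ti.det‖ ^ 2 ≠ 0 := by
    intro h0
    have := h4 0
    rw [h0] at this
    simp at this
  have h5 : (fun τ : ℝ => PP G i (gᴴ * (1 + (τ : ℂ) • X) * g)) = fun τ : ℝ =>
      (1 + (τ : ℂ) • ((colsLE Q i)ᴴ * X * colsLE Q i)).det.re / ‖Ti.det‖ ^ 2 := by
    funext τ
    rw [← h4 τ, mul_div_cancel_left₀ _ hT0]
  have h6 := (hasDerivAt_det_one_add ((colsLE Q i)ᴴ * X * colsLE Q i)).div_const (‖Ti.det‖ ^ 2)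
  rw [← h5] at h6
  have h70 := congrFun h5 0
  simp only [Complex.ofReal_zero, zero_smul, add_zero, Matrix.det_one, Complex.one_re] at h70
  have h7 : PP G i (gᴴ * (1 + ((0 : ℝ) : ℂ) • X) * g) = 1 / ‖Ti.det‖ ^ 2 := by
    simpa using h70
  have h8 := h6.log (by rw [h7]; exact one_div_ne_zero hT0)
  rw [h7] at h8
  convert! h8 using 1
  rw [div_div_div_cancel_right₀ hT0, div_one, Matrix.trace, Complex.re_sum]
  rfl

end

section
open Module Matrix
open scoped ComplexOrder

/-- The moment map value `∑ Q_l Λ_l Q_lᴴ - t`. -/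
noncomputable def MM {s r : ℕ} (Λ : Fin s → Fin r → ℝ) (t : ℝ)
    (Q : Fin s → Matrix (Fin r) (Fin r) ℂ) : Matrix (Fin r) (Fin r) ℂ :=
  ∑ l, Q l * diagonal (fun j => (Λ l j : ℂ)) * (Q l)ᴴ - (t : ℂ) • 1

lemma MM_herm {s r : ℕ} (Λ : Fin s → Fin r → ℝ) (t : ℝ)
    (Q : Fin s → Matrix (Fin r) (Fin r) ℂ) : (MM Λ t Q).IsHermitian := by
  unfold MM Matrix.IsHermitian
  rw [Matrix.conjTranspose_sub, Matrix.conjTranspose_sum, Matrix.conjTranspose_smul,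
    Matrix.conjTranspose_one]
  congr 1
  · refine Finset.sum_congr rfl fun l _ => ?_
    rw [Matrix.conjTranspose_mul, Matrix.conjTranspose_mul, Matrix.conjTranspose_conjTranspose,
      Matrix.diagonal_conjTranspose, Matrix.mul_assoc]
    congr 3
    ext j
    simp
  · simp

lemma MM_trace {s r : ℕ} (Λ : Fin s → Fin r → ℝ) (t : ℝ) (htot : TT Λ = r * t)
    (Q : Fin s → Matrix (Fin r) (Fin r) ℂ) (hQ : ∀ l, (Q l)ᴴ * Q l = 1) :
    (MM Λ t Q).trace = 0 := by
  unfold MM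
  rw [Matrix.trace_sub, Matrix.trace_sum, Matrix.trace_smul, Matrix.trace_one]
  have h1 : ∀ l, (Q l * diagonal (fun j => (Λ l j : ℂ)) * (Q l)ᴴ).trace = ∑ j, (Λ l j : ℂ) := by
    intro l
    rw [Matrix.trace_mul_comm, ← Matrix.mul_assoc, hQ, Matrix.one_mul, Matrix.trace_diagonal]
  rw [Finset.sum_congr rfl fun l _ => h1 l]
  have h2 : ((TT Λ : ℝ) : ℂ) = ∑ l, ∑ j, (Λ l j : ℂ) := by
    unfold TT; push_cast; rfl
  rw [← h2, htot]
  push_cast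
  simp
  ring

lemma MM_diag_bound {s r : ℕ} (Λ : Fin s → Fin r → ℝ) (t : ℝ)
    (Q : Fin s → Matrix (Fin r) (Fin r) ℂ) (hQ : ∀ l, (Q l)ᴴ * Q l = 1) (i : Fin r) :
    ‖MM Λ t Q i i‖ ≤ ∑ l, ∑ j, |Λ l j| + |t| := by
  unfold MM
  rw [Matrix.sub_apply, Matrix.sum_apply]
  refine (norm_sub_le _ _).trans (add_le_add ?_ ?_)
  · refine (norm_sum_le _ _).trans (Finset.sum_le_sum fun l _ => ?_)
    rw [Matrix.mul_apply]
    refine (norm_sum_le _ _).trans (Finset.sum_le_sum fun j _ => ?_)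
    rw [Matrix.mul_diagonal, Matrix.conjTranspose_apply, norm_mul, norm_mul, norm_star,
      Complex.norm_real, Real.norm_eq_abs]
    have h1 := norm_entry_le_one (Q l) (hQ l) i j
    have h2 := norm_nonneg (Q l i j)
    calc _ ≤ 1 * |Λ l j| * 1 := by gcongr
      _ = _ := by ring
  · simp

lemma MM_pairing {s r : ℕ} (Λ : Fin s → Fin r → ℝ) (t : ℝ)
    (Q : Fin s → Matrix (Fin r) (Fin r) ℂ) (X : Matrix (Fin r) (Fin r) ℂ) :
    ∑ l, ∑ j, Λ l j * (((Q l)ᴴ * X * Q l) j j).re =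
      (X * MM Λ t Q).trace.re + t * X.trace.re := by
  have h1 : X * MM Λ t Q = ∑ l, X * (Q l * diagonal (fun j => (Λ l j : ℂ)) * (Q l)ᴴ) -
      (t : ℂ) • X := by
    rw [MM, Matrix.mul_sub, Matrix.mul_sum, Matrix.mul_smul, Matrix.mul_one]
  rw [h1, Matrix.trace_sub, Matrix.trace_sum, Matrix.trace_smul, Complex.sub_re, smul_eq_mul,
    Complex.re_ofReal_mul, sub_add_cancel, Complex.re_sum]
  refine Finset.sum_congr rfl fun l _ => ?_
  have h2 : (X * (Q l * diagonal (fun j => (Λ l j : ℂ)) * (Q l)ᴴ)).trace =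
      ((Q l)ᴴ * X * Q l * diagonal (fun j => (Λ l j : ℂ))).trace := by
    rw [← Matrix.mul_assoc, Matrix.trace_mul_comm]
    simp only [Matrix.mul_assoc]
  rw [h2, Matrix.trace, Complex.re_sum]
  refine Finset.sum_congr rfl fun j _ => ?_
  rw [Matrix.diag_apply, Matrix.mul_diagonal, mul_comm _ (Λ l j : ℂ), Complex.re_ofReal_mul]

lemma hasDerivAt_log_det {r : ℕ} (g X : Matrix (Fin r) (Fin r) ℂ) (hg : IsUnit g.det) :
    HasDerivAt (fun τ : ℝ => Real.log (gᴴ * (1 + (τ : ℂ) • X) * g).det.re) X.trace.re 0 := by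
  have hT0 : ‖g.det‖ ^ 2 ≠ 0 := pow_ne_zero _ (norm_ne_zero_iff.mpr hg.ne_zero)
  have h5 : (fun τ : ℝ => (gᴴ * (1 + (τ : ℂ) • X) * g).det.re) = fun τ : ℝ =>
      ‖g.det‖ ^ 2 * (1 + (τ : ℂ) • X).det.re := by
    funext τ
    have h9 : ∀ D : ℂ, (starRingEnd ℂ) g.det * D * g.det = ((‖g.det‖ ^ 2 : ℝ) : ℂ) * D := by
      intro D
      rw [mul_right_comm, Complex.conj_mul', Complex.ofReal_pow]
    rw [Matrix.det_mul, Matrix.det_mul, Matrix.det_conjTranspose, Complex.star_def, h9,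
      Complex.re_ofReal_mul]
  have h6 := (hasDerivAt_det_one_add X).const_mul (‖g.det‖ ^ 2)
  rw [← h5] at h6
  have h70 := congrFun h5 0
  have h7 : (gᴴ * (1 + ((0 : ℝ) : ℂ) • X) * g).det.re = ‖g.det‖ ^ 2 := by
    rw [h70]; simp
  have h8 := h6.log (by rw [h7]; exact hT0)
  rw [h7, mul_div_cancel_left₀ _ hT0] at h8
  exact h8

lemma hasDerivAt_log_trace {r : ℕ} (g X : Matrix (Fin r) (Fin r) ℂ)
    (hg : (gᴴ * g).trace.re ≠ 0) :
    HasDerivAt (fun τ : ℝ => Real.log (gᴴ * (1 + (τ : ℂ) • X) * g).trace.re)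
      ((gᴴ * X * g).trace.re / (gᴴ * g).trace.re) 0 := by
  have h5 : (fun τ : ℝ => (gᴴ * (1 + (τ : ℂ) • X) * g).trace.re) = fun τ : ℝ =>
      (gᴴ * g).trace.re + τ * (gᴴ * X * g).trace.re := by
    funext τ
    rw [Matrix.mul_add, Matrix.add_mul, Matrix.mul_one, Matrix.mul_smul, Matrix.smul_mul,
      Matrix.trace_add, Matrix.trace_smul, Complex.add_re, smul_eq_mul, Complex.re_ofReal_mul]
  have h6 : HasDerivAt (fun τ : ℝ => (gᴴ * g).trace.re + τ * (gᴴ * X * g).trace.re)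
      ((gᴴ * X * g).trace.re) 0 := by
    simpa using ((hasDerivAt_id (0 : ℝ)).mul_const ((gᴴ * X * g).trace.re)).const_add
      ((gᴴ * g).trace.re)
  rw [← h5] at h6
  have h7 : (gᴴ * (1 + ((0 : ℝ) : ℂ) • X) * g).trace.re = (gᴴ * g).trace.re := by simp
  have h8 := h6.log (by rw [h7]; exact hg)
  rw [h7] at h8
  exact h8

lemma critical {s r : ℕ} (hr : 1 ≤ r) (Λ : Fin s → Fin r → ℝ) (t : ℝ)
    (G : Fin s → Matrix (Fin r) (Fin r) ℂ) (hG : ∀ l, IsUnit (G l).det)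
    (htot : TT Λ = r * t) (c : Fin s → Fin r → ℝ)
    (hc : ∀ l (v : Fin r → ℝ), ∑ i, c l i * ∑ j : {j : Fin r // j ≤ i}, v j = ∑ j, Λ l j * v j)
    (ε : ℝ) (hε : 0 < ε) (U : Matrix (Fin r) (Fin r) ℂ) (x : Fin r → ℝ) (hU : Uᴴ * U = 1)
    (hmin : ∀ h : Matrix (Fin r) (Fin r) ℂ, h.PosDef →
        Psi G c t ε (hh U x) ≤ Psi G c t ε h) :
    ∃ Q : Fin s → Matrix (Fin r) (Fin r) ℂ, (∀ l, (Q l)ᴴ * Q l = 1) ∧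
      ((MM Λ t Q)ᴴ * MM Λ t Q).trace.re ≤ ε * r * (∑ l, ∑ j, |Λ l j| + |t|) := by
  have hU' : U * Uᴴ = 1 := mul_eq_one_comm.mp hU
  let g : Matrix (Fin r) (Fin r) ℂ := diagonal (fun i => ((Real.exp (x i / 2) : ℝ) : ℂ)) * Uᴴ
  have hdd : diagonal (fun i => ((Real.exp (x i / 2) : ℝ) : ℂ)) *
      diagonal (fun i => ((Real.exp (x i / 2) : ℝ) : ℂ)) =
      diagonal (fun i => ((Real.exp (x i) : ℝ) : ℂ)) := by
    rw [Matrix.diagonal_mul_diagonal]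
    congr 1
    funext i
    rw [← Complex.ofReal_mul, ← Real.exp_add, add_halves]
  have hgH : gᴴ = U * diagonal (fun i => ((Real.exp (x i / 2) : ℝ) : ℂ)) := by
    simp only [g]
    rw [Matrix.conjTranspose_mul, Matrix.conjTranspose_conjTranspose,
      Matrix.diagonal_conjTranspose]
    congr 2
    funext i
    simp [← Complex.ofReal_exp]
  have hgg : gᴴ * g = hh U x := by
    rw [hgH, hh, ← hdd]; simp only [g, Matrix.mul_assoc]
  have hgg' : g * gᴴ = diagonal (fun i => ((Real.exp (x i) : ℝ) : ℂ)) := by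
    rw [hgH, ← hdd]; simp only [g]
    rw [Matrix.mul_assoc, ← Matrix.mul_assoc Uᴴ, hU, Matrix.one_mul]
  have hgu : IsUnit g.det := by
    have h1 : (gᴴ * g).det.re ≠ 0 := by
      rw [hgg, hh_det U hU]; exact (Real.exp_pos _).ne'
    rw [isUnit_iff_ne_zero]
    intro h0
    rw [Matrix.det_mul, h0, mul_zero] at h1
    simp at h1
  have htr : (gᴴ * g).trace.re = ∑ i, Real.exp (x i) := by rw [hgg, hh_trace U hU]
  have htrpos : 0 < (gᴴ * g).trace.re := by
    rw [hgg]; exact PosDef_trace_re hr (hh_posDef U hU x)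
  choose Q T hQ hT hA using fun l => exists_qr (g * G l) (by
    rw [Matrix.det_mul]; exact hgu.mul (hG l))
  refine ⟨Q, hQ, ?_⟩
  have hX := MM_herm Λ t Q
  have hX0 := MM_trace Λ t htot Q hQ
  have hXb := MM_diag_bound Λ t Q hQ
  have hpair := MM_pairing Λ t Q (MM Λ t Q)
  rw [hX.eq]
  generalize MM Λ t Q = X at hX hX0 hXb hpair
  have hd : HasDerivAt (fun τ : ℝ => Psi G c t ε (gᴴ * (1 + (τ : ℂ) • X) * g))
      (∑ l, ∑ i, c l i * ∑ j : {j : Fin r // j ≤ i}, (((Q l)ᴴ * X * Q l) j j).re -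
        (t + ε) * X.trace.re + ε * r * ((gᴴ * X * g).trace.re / (gᴴ * g).trace.re)) 0 := by
    unfold Psi
    refine HasDerivAt.add (HasDerivAt.sub ?_ ?_) ?_
    · refine HasDerivAt.fun_sum fun l _ => HasDerivAt.fun_sum fun i _ => ?_
      exact (deriv_log_PP (G l) g (Q l) (T l) (hQ l) (hT l) (hA l) X i).const_mul _
    · exact (hasDerivAt_log_det g X hgu).const_mul _
    · exact (hasDerivAt_log_trace g X htrpos.ne').const_mul _
  have hloc : IsLocalMin (fun τ : ℝ => Psi G c t ε (gᴴ * (1 + (τ : ℂ) • X) * g)) 0 := by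
    filter_upwards [posDef_small X hX] with τ hτ
    have h0 : gᴴ * (1 + ((0 : ℝ) : ℂ) • X) * g = hh U x := by simp [hgg]
    rw [h0]
    refine hmin _ (hτ.conjTranspose_mul_mul_same ?_)
    exact Matrix.mulVec_injective_of_isUnit ((Matrix.isUnit_iff_isUnit_det g).mpr hgu)
  have hz := hloc.hasDerivAt_eq_zero hd
  rw [Finset.sum_congr rfl fun l _ => hc l (fun j => (((Q l)ᴴ * X * Q l) j j).re), hpair, hX0] at hz
  simp only [Complex.zero_re, mul_zero, add_zero, sub_zero] at hz
  have htx : (gᴴ * X * g).trace.re = ∑ i, (X i i).re * Real.exp (x i) := by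
    rw [Matrix.mul_assoc, Matrix.trace_mul_comm, Matrix.mul_assoc, hgg', Matrix.trace,
      Complex.re_sum]
    refine Finset.sum_congr rfl fun i _ => ?_
    rw [Matrix.diag_apply, Matrix.mul_diagonal, Complex.re_mul_ofReal]
  have hb : -(∑ l, ∑ j, |Λ l j| + |t|) * (gᴴ * g).trace.re ≤ (gᴴ * X * g).trace.re := by
    rw [htx, htr, Finset.mul_sum]
    refine Finset.sum_le_sum fun i _ => ?_
    have h1 := (Complex.abs_re_le_norm (X i i)).trans (hXb i)
    have h2 := (abs_le.mp h1).1
    exact mul_le_mul_of_nonneg_right h2 (Real.exp_pos _).le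
  have hb2 : -(∑ l, ∑ j, |Λ l j| + |t|) ≤ (gᴴ * X * g).trace.re / (gᴴ * g).trace.re := by
    rw [le_div_iff₀ htrpos]; exact hb
  have hb3 := mul_le_mul_of_nonneg_left hb2 (by positivity : 0 ≤ ε * (r : ℝ))
  linarith

end

section
open Module Matrix
open scoped ComplexOrder

lemma exists_coeff {r : ℕ} (a : Fin r → ℝ) (ha : Antitone a) (h0 : ∀ i, 0 ≤ a i) :
    ∃ c : Fin r → ℝ, (∀ i, 0 ≤ c i) ∧ ∀ v : Fin r → ℝ,
      ∑ i, c i * ∑ j : {j : Fin r // j ≤ i}, v j = ∑ j, a j * v j := by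
  let f : ℕ → ℝ := fun n => if h : n < r then a ⟨n, h⟩ else 0
  have hf : ∀ i : Fin r, f i = a i := fun i => by simp [f]
  have hfr : f r = 0 := by simp [f]
  refine ⟨fun i => f i - f (i + 1), fun i => ?_, fun v => ?_⟩
  · show 0 ≤ f i - f (i + 1)
    rw [hf]
    by_cases h : (i : ℕ) + 1 < r
    · have : f (i + 1) = a ⟨i + 1, h⟩ := by simp [f, h]
      rw [this]
      exact sub_nonneg.mpr (ha (by rw [Fin.le_def]; simp))
    · have : f (i + 1) = 0 := by simp only [f]; rw [dif_neg h]
      rw [this]; simpa using h0 i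
  · have h1 : ∀ i : Fin r, ∑ j : {j : Fin r // j ≤ i}, v j = ∑ j, if j ≤ i then v j else 0 := by
      intro i
      rw [← Finset.sum_filter]
      exact (Finset.sum_subtype (Finset.univ.filter fun j : Fin r => j ≤ i) (by simp) v).symm
    simp only [h1, Finset.mul_sum]
    rw [Finset.sum_comm]
    refine Finset.sum_congr rfl fun j _ => ?_
    have h2 : ∑ i : Fin r, (if j ≤ i then f i - f (i + 1) else 0) = a j := by
      have h3 : ∑ i : Fin r, (if j ≤ i then f i - f (i + 1) else 0) =
          ∑ n ∈ Finset.range r, (if (j : ℕ) ≤ n then f n - f (n + 1) else 0) := by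
        rw [← Fin.sum_univ_eq_sum_range (fun n => if (j : ℕ) ≤ n then f n - f (n + 1) else 0)]
        rfl
      have h4 : (Finset.range r).filter (fun n => (j : ℕ) ≤ n) = Finset.Ico (j : ℕ) r := by
        ext n; simp; tauto
      rw [h3, ← Finset.sum_filter, h4]
      have h5 := Finset.sum_Ico_sub f j.2.le
      have h6 : ∑ n ∈ Finset.Ico (j : ℕ) r, (f n - f (n + 1)) =
          - ∑ n ∈ Finset.Ico (j : ℕ) r, (f (n + 1) - f n) := by
        rw [← Finset.sum_neg_distrib]
        exact Finset.sum_congr rfl fun _ _ => by ring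
      rw [h6, h5, hfr, hf]; ring
    rw [← h2, Finset.sum_mul]
    refine Finset.sum_congr rfl fun i _ => ?_
    split_ifs <;> simp

lemma suff_nonneg {s r : ℕ} (hs : 0 < s) (hr : 1 ≤ r) (Λ : Fin s → Fin r → ℝ) (t : ℝ)
    (hΛ : ∀ l, Antitone (Λ l)) (h0 : ∀ l i, 0 ≤ Λ l i) (htot : TT Λ = r * t)
    (hhorn : ∀ (d : ℕ), 1 ≤ d → d < r →
      ∀ J : Fin s → Fin d → Fin r, (∀ l, StrictMono (J l)) → Intersecting J →
        TJ J Λ ≤ (d : ℝ) * t) :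
    ∃ W : Fin s → Matrix (Fin r) (Fin r) ℂ, (∀ l, (W l)ᴴ * W l = 1) ∧
      ∑ l, W l * diagonal (fun i => (Λ l i : ℂ)) * (W l)ᴴ = (t : ℂ) • 1 := by
  obtain ⟨H, hH, hgen⟩ := exists_generic s r hs
  choose c hc0 hc using fun l => exists_coeff (Λ l) (hΛ l) (h0 l)
  have hG : ∀ l, IsUnit ((H l)⁻¹).det := fun l => Matrix.isUnit_nonsing_inv_det _ (hH l)
  have key : ∀ ε : ℝ, 0 < ε → ∃ Q : Fin s → Matrix (Fin r) (Fin r) ℂ,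
      (∀ l, (Q l)ᴴ * Q l = 1) ∧
      ((MM Λ t Q)ᴴ * MM Λ t Q).trace.re ≤ ε * r * (∑ l, ∑ j, |Λ l j| + |t|) := by
    intro ε hε
    obtain ⟨U, x, hU, hmin⟩ := exists_min_aux hr Λ t (fun l => (H l)⁻¹) hG htot c hc0 hc ε hε
      (fun U hU u hu hu0 C => Psi_lower hr Λ t H hH hgen htot hhorn c hc0 hc ε hε U hU u hu hu0 C)
    exact critical hr Λ t _ hG htot c hc ε hε U x hU hmin
  let K : Set (Fin s → Matrix (Fin r) (Fin r) ℂ) :=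
    Set.univ.pi fun _ => {Q : Matrix (Fin r) (Fin r) ℂ | Qᴴ * Q = 1}
  have hK : IsCompact K := isCompact_univ_pi fun _ => isCompact_frames _ _
  have hne : K.Nonempty := ⟨fun _ => 1, fun l _ => by simp [Set.mem_ofPred_eq]⟩
  have hcont : Continuous fun Q : Fin s → Matrix (Fin r) (Fin r) ℂ =>
      ((MM Λ t Q)ᴴ * MM Λ t Q).trace.re := by
    have hM : Continuous fun Q : Fin s → Matrix (Fin r) (Fin r) ℂ => MM Λ t Q := by
      unfold MM
      fun_prop
    fun_prop
  obtain ⟨W, hWK, hWmin⟩ := hK.exists_isMinOn hne hcont.continuousOn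
  refine ⟨W, fun l => hWK l (Set.mem_univ l), ?_⟩
  have hle : ((MM Λ t W)ᴴ * MM Λ t W).trace.re ≤ 0 := by
    set B : ℝ := r * (∑ l, ∑ j, |Λ l j| + |t|) with hB
    have hB0 : 0 ≤ B := by positivity
    refine le_of_forall_pos_le_add fun δ hδ => ?_
    obtain ⟨Q, hQ, hQ2⟩ := key (δ / (B + 1)) (by positivity)
    have h1 : ((MM Λ t W)ᴴ * MM Λ t W).trace.re ≤ ((MM Λ t Q)ᴴ * MM Λ t Q).trace.re :=
      hWmin (fun l _ => hQ l)
    have h2 : δ / (B + 1) * r * (∑ l, ∑ j, |Λ l j| + |t|) = δ / (B + 1) * B := by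
      rw [hB]; ring
    have h3 : δ / (B + 1) * B ≤ δ := by
      rw [div_mul_eq_mul_div, div_le_iff₀ (by positivity)]
      nlinarith
    linarith
  have hpsd := (Matrix.posSemidef_conjTranspose_mul_self (MM Λ t W)).trace_nonneg
  have hz : ((MM Λ t W)ᴴ * MM Λ t W).trace = 0 := by
    rw [Complex.le_def] at hpsd
    apply Complex.ext
    · exact le_antisymm hle hpsd.1
    · exact hpsd.2.symm
  have hM0 : MM Λ t W = 0 := Matrix.trace_conjTranspose_mul_self_eq_zero_iff.mp hz
  exact sub_eq_zero.mp hM0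

lemma suff {s r : ℕ} (hs : 0 < s) (hr : 1 ≤ r) (Λ : Fin s → Fin r → ℝ) (t : ℝ)
    (hΛ : ∀ l, Antitone (Λ l)) (htot : TT Λ = r * t)
    (hhorn : ∀ (d : ℕ), 1 ≤ d → d < r →
      ∀ J : Fin s → Fin d → Fin r, (∀ l, StrictMono (J l)) → Intersecting J →
        TJ J Λ ≤ (d : ℝ) * t) :
    ∃ W : Fin s → Matrix (Fin r) (Fin r) ℂ, (∀ l, (W l)ᴴ * W l = 1) ∧
      ∑ l, W l * diagonal (fun i => (Λ l i : ℂ)) * (W l)ᴴ = (t : ℂ) • 1 := by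
  set a : ℝ := ∑ l, ∑ j, |Λ l j| with ha
  have ha1 : ∀ l i, 0 ≤ Λ l i + a := by
    intro l i
    have h1 : |Λ l i| ≤ ∑ j, |Λ l j| :=
      Finset.single_le_sum (f := fun j => |Λ l j|) (fun j _ => abs_nonneg _) (Finset.mem_univ i)
    have h2 : ∑ j, |Λ l j| ≤ a :=
      Finset.single_le_sum (f := fun l => ∑ j, |Λ l j|)
        (fun j _ => Finset.sum_nonneg fun _ _ => abs_nonneg _) (Finset.mem_univ l)
    have h3 := neg_abs_le (Λ l i)
    linarith
  obtain ⟨W, hW, hsum⟩ := suff_nonneg hs hr (fun l i => Λ l i + a) (t + s * a)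
    (fun l i j hij => by simpa using hΛ l hij) ha1
    (by
      unfold TT at htot ⊢
      simp only [Finset.sum_add_distrib, htot]
      simp
      ring)
    (by
      intro d hd hdr J hJ hI
      have := hhorn d hd hdr J hJ hI
      unfold TJ at this ⊢
      simp only [Finset.sum_add_distrib]
      simp
      nlinarith)
  refine ⟨W, hW, ?_⟩
  have h1 : ∀ l, W l * diagonal (fun i => ((Λ l i + a : ℝ) : ℂ)) * (W l)ᴴ =
      W l * diagonal (fun i => (Λ l i : ℂ)) * (W l)ᴴ + (a : ℂ) • 1 := by
    intro l
    have hd : diagonal (fun i => ((Λ l i + a : ℝ) : ℂ)) =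
        diagonal (fun i => (Λ l i : ℂ)) + (a : ℂ) • (1 : Matrix (Fin r) (Fin r) ℂ) := by
      ext i j
      by_cases h : i = j
      · subst h; simp
      · simp [h]
    have hW' : W l * (W l)ᴴ = 1 := mul_eq_one_comm.mp (hW l)
    rw [hd, Matrix.mul_add, Matrix.add_mul, Matrix.mul_smul, Matrix.smul_mul, Matrix.mul_one, hW']
  simp only [h1, Finset.sum_add_distrib] at hsum
  have h2 : ∑ _l : Fin s, (a : ℂ) • (1 : Matrix (Fin r) (Fin r) ℂ) =
      ((s : ℂ) * a) • 1 := by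
    rw [Finset.sum_const, Finset.card_univ, Fintype.card_fin, mul_smul, Nat.cast_smul_eq_nsmul]
  rw [h2] at hsum
  have h3 : ((t + s * a : ℝ) : ℂ) • (1 : Matrix (Fin r) (Fin r) ℂ) =
      (t : ℂ) • 1 + ((s : ℂ) * a) • 1 := by
    rw [← add_smul]; push_cast; rfl
  rw [h3] at hsum
  exact add_right_cancel hsum

end

/-- **Horn inequalities for the Kirwan cone.** `(Λ,t) ∈ E(r,s)` lies in `𝒦(r,s)`
iff `T(Λ) = r t` and `T_𝐉(Λ) ≤ d t` for all `d ∈ [r-1]` and all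
`𝐉 ∈ Intersecting(d,r,s)`. -/
theorem horn_inequalities_kirwan (s r : ℕ) (hs : 2 ≤ s) (hr : 1 ≤ r)
    (Λ : Fin s → Fin r → ℝ) (t : ℝ) (hΛ : ∀ l, Antitone (Λ l)) :
    KirwanMem Λ t ↔
      (TT Λ = (r : ℝ) * t ∧
        ∀ (d : ℕ), 1 ≤ d → d < r →
          ∀ J : Fin s → Fin d → Fin r, (∀ l, StrictMono (J l)) → Intersecting J →
            TJ J Λ ≤ (d : ℝ) * t) := by
  constructor
  · intro hk
    obtain ⟨h1, h2⟩ := necessity (by omega) Λ t hΛ hk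
    exact ⟨h1, fun d _ _ J hJ hI => h2 d J hJ hI⟩
  · rintro ⟨h1, h2⟩
    exact (kirwan_iff Λ t hΛ).mpr (suff (by omega) hr Λ t hΛ h1 h2)
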